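/- arXiv:1911.09136 — 2 statements merged into one kernel-verified Lean document; each statement's English description precedes it below -/
import Mathlib

section
/- Let f_1, …, f_k : ℕ → ℕ be functions given by polynomials with integer coefficients, and for each n let S_n ⊆ ℕ be the additive submonoid generated by f_1(n), …, f_k(n). Then the set of all n ∈ ℕ for which S_n is an irreducible numerical semigroup (i.e., ℕ \ S_n is finite and S_n cannot be written as T_1 ∩ T_2 where T_1, T_2 are additive submonoids of ℕ with finite complement each strictly containing S_n) is eventually periodic. -/
/-- A set `A ⊆ ℕ` is eventually periodic if there are `N` and `p ≥ 1` such that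
for all `n ≥ N`, `n ∈ A ↔ n + p ∈ A`. -/
def EvPeriodicSet (A : Set ℕ) : Prop :=
  ∃ N p : ℕ, 1 ≤ p ∧ ∀ n, N ≤ n → (n ∈ A ↔ n + p ∈ A)

/-- The additive submonoid of `ℕ` generated by `f 0 n, …, f (k-1) n`. -/
def SG (k : ℕ) (f : Fin k → ℕ → ℕ) (n : ℕ) : AddSubmonoid ℕ :=
  AddSubmonoid.closure (Set.range fun i => f i n)

/-! ### Irreducibility through the conductor -/

/-- `S` is a numerical semigroup that is not the intersection of two numerical semigroups strictly
containing it. -/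
def IsIrredNumSemigroup (S : AddSubmonoid ℕ) : Prop :=
  ((S : Set ℕ)ᶜ).Finite ∧
    ¬ ∃ T₁ T₂ : AddSubmonoid ℕ,
      ((T₁ : Set ℕ)ᶜ).Finite ∧ ((T₂ : Set ℕ)ᶜ).Finite ∧ S < T₁ ∧ S < T₂ ∧ S = T₁ ⊓ T₂

/-- Adjoining to `S` a number `h` whose sums with itself and with nonzero elements of `S` stay
in `S`. -/
def adjoinGap (S : AddSubmonoid ℕ) (h : ℕ) (hh : h + h ∈ S)
    (hs : ∀ s ∈ S, s ≠ 0 → h + s ∈ S) : AddSubmonoid ℕ where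
  carrier := {x | x ∈ S ∨ x = h}
  zero_mem' := Or.inl S.zero_mem
  add_mem' := by
    have key : ∀ s ∈ S, h + s ∈ S ∨ h + s = h := fun s hsS => by
      by_cases h0 : s = 0
      · exact Or.inr (by simp [h0])
      · exact Or.inl (hs s hsS h0)
    rintro a b (ha | rfl) (hb | rfl)
    · exact Or.inl (S.add_mem ha hb)
    · rw [add_comm]; exact key a ha
    · exact key b hb
    · exact Or.inl hh

theorem mem_adjoinGap {S : AddSubmonoid ℕ} {h : ℕ} {hh hs} {x : ℕ} :
    x ∈ adjoinGap S h hh hs ↔ x ∈ S ∨ x = h := Iff.rfl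

theorem lt_adjoinGap {S : AddSubmonoid ℕ} {h : ℕ} {hh hs} (hS : h ∉ S) :
    S < adjoinGap S h hh hs :=
  SetLike.lt_iff_le_and_exists.2
    ⟨fun _ hx => Or.inl hx, h, Or.inr rfl, hS⟩

/-- `G` is the conductor of `S`, and `S` is symmetric or pseudo-symmetric. -/
def IsSymmetricConductor (S : AddSubmonoid ℕ) (G : ℕ) : Prop :=
  (∀ z, z + 1 = G → z ∉ S) ∧ (∀ m, G ≤ m → m ∈ S) ∧
    ∀ x y, x + y + 1 = G → x ∈ S ∨ y ∈ S ∨ x = y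

theorem IsSymmetricConductor.isIrredNumSemigroup {S : AddSubmonoid ℕ} {G : ℕ}
    (hG : IsSymmetricConductor S G) : IsIrredNumSemigroup S := by
  obtain ⟨h₁, h₂, h₃⟩ := hG
  refine ⟨(Set.finite_lt_nat G).subset fun x hx => ?_, ?_⟩
  · by_contra hlt
    exact hx (h₂ x (not_lt.1 hlt))
  rintro ⟨T₁, T₂, -, -, hT₁, hT₂, hS⟩
  have key : ∀ T : AddSubmonoid ℕ, S < T → ∀ z, z + 1 = G → z ∈ T := by
    intro T hT z hz
    obtain ⟨hle, x, hxT, hxS⟩ := SetLike.lt_iff_le_and_exists.1 hT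
    have hxG : x < G := by
      by_contra hlt
      exact hxS (h₂ x (not_lt.1 hlt))
    obtain ⟨y, hy⟩ : ∃ y, x + y = z := ⟨z - x, by omega⟩
    rcases h₃ x y (by omega) with h | h | h
    · exact absurd h hxS
    · rw [← hy]; exact T.add_mem hxT (hle h)
    · rw [← hy, ← h]; exact T.add_mem hxT hxT
  obtain ⟨-, x, -, hxS⟩ := SetLike.lt_iff_le_and_exists.1 hT₁
  have hxG : x < G := by
    by_contra hlt
    exact hxS (h₂ x (not_lt.1 hlt))
  obtain ⟨z, hz⟩ : ∃ z, z + 1 = G := ⟨G - 1, by omega⟩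
  refine h₁ z hz ?_
  rw [hS]
  exact ⟨key T₁ hT₁ z hz, key T₂ hT₂ z hz⟩

theorem exists_conductor {S : AddSubmonoid ℕ} (hS : ((S : Set ℕ)ᶜ).Finite) :
    ∃ G, (∀ z, z + 1 = G → z ∉ S) ∧ ∀ m, G ≤ m → m ∈ S := by
  classical
  have hex : ∃ G, ∀ m, G ≤ m → m ∈ S := by
    obtain ⟨b, hb⟩ := hS.bddAbove
    refine ⟨b + 1, fun m hm => ?_⟩
    by_contra h
    have := hb (show m ∈ (S : Set ℕ)ᶜ from h)
    omega
  refine ⟨Nat.find hex, fun z hz hzS => ?_, Nat.find_spec hex⟩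
  refine Nat.find_min hex (m := z) (by omega) fun m hm => ?_
  rcases hm.eq_or_lt with rfl | hlt
  · exact hzS
  · exact Nat.find_spec hex m (by omega)

theorem IsIrredNumSemigroup.exists_isSymmetricConductor {S : AddSubmonoid ℕ}
    (hS : IsIrredNumSemigroup S) : ∃ G, IsSymmetricConductor S G := by
  classical
  obtain ⟨hfin, hirr⟩ := hS
  obtain ⟨G, h₁, h₂⟩ := exists_conductor hfin
  refine ⟨G, h₁, h₂, ?_⟩
  by_contra! hcon
  obtain ⟨x₀, y₀, hG, hx₀, hy₀, hne⟩ := hcon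
  -- the largest gap paired with another, different, gap
  let P : ℕ → Prop := fun h => h ∉ S ∧ ∃ y, h + y + 1 = G ∧ y ∉ S ∧ h ≠ y
  have hP₀ : P x₀ := ⟨hx₀, y₀, hG, hy₀, hne⟩
  have hP₁ : P y₀ := ⟨hy₀, x₀, by omega, hx₀, hne.symm⟩
  obtain ⟨hhS, y, hy, hyS, hhy⟩ : P (Nat.findGreatest P G) :=
    Nat.findGreatest_spec (m := x₀) (by omega) hP₀
  have hmax : ∀ m, P m → m ≤ Nat.findGreatest P G := fun m hm =>
    Nat.le_findGreatest (by obtain ⟨-, y', h, -⟩ := hm; omega) hm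
  have hx₀m := hmax _ hP₀
  have hy₀m := hmax _ hP₁
  generalize Nat.findGreatest P G = h at hhS hy hhy hmax hx₀m hy₀m
  have hyh : y < h := by omega
  have hy0 : y ≠ 0 := fun h0 => hyS (h0 ▸ S.zero_mem)
  have hFS : G - 1 ∉ S := h₁ _ (by omega)
  refine hirr ⟨adjoinGap S (G - 1) (h₂ _ (by omega)) (fun s _ hs0 => h₂ _ (by omega)),
    adjoinGap S h (h₂ _ (by omega)) (fun s hs hs0 => ?_), ?_, ?_, lt_adjoinGap hFS,
    lt_adjoinGap hhS, ?_⟩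
  · by_contra hhs
    have hlt : h + s < G := by
      by_contra hlt
      exact hhs (h₂ _ (not_lt.1 hlt))
    have hsy : s ≤ y := by omega
    obtain ⟨u, rfl⟩ := Nat.exists_eq_add_of_le hsy
    have hu : u ∉ S := fun hu => hyS (S.add_mem hs hu)
    have := hmax (h + s) ⟨hhs, u, by omega, hu, by omega⟩
    omega
  · exact hfin.subset (Set.compl_subset_compl.2 fun x hx => Or.inl hx)
  · exact hfin.subset (Set.compl_subset_compl.2 fun x hx => Or.inl hx)
  · ext x
    rw [AddSubmonoid.mem_inf, mem_adjoinGap, mem_adjoinGap]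
    constructor
    · exact fun hx => ⟨Or.inl hx, Or.inl hx⟩
    · rintro ⟨hx | hx, hx' | hx'⟩
      · exact hx
      · exact hx
      · exact hx'
      · omega

/-! ### Bounding the quantifiers -/

theorem mem_closure_range_nat_iff {k : ℕ} (a : Fin k → ℕ) (x : ℕ) :
    x ∈ AddSubmonoid.closure (Set.range a) ↔ ∃ y : Fin k → ℕ, x = ∑ i, y i * a i := by
  rw [AddSubmonoid.mem_closure_range_iff_of_fintype]
  simp

/-- Coefficients in a representation can be chosen no larger than the represented number. -/
theorem exists_le_of_mem_closure_range {k : ℕ} {a : Fin k → ℕ} {x : ℕ}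
    (hx : x ∈ AddSubmonoid.closure (Set.range a)) :
    ∃ y : Fin k → ℕ, (∀ i, y i ≤ x) ∧ x = ∑ i, y i * a i := by
  obtain ⟨y, hy⟩ := (mem_closure_range_nat_iff a x).1 hx
  refine ⟨fun i => if a i = 0 then 0 else y i, fun i => ?_, ?_⟩
  · dsimp only
    split_ifs with h
    · exact Nat.zero_le _
    · calc y i ≤ y i * a i := Nat.le_mul_of_pos_right _ (Nat.pos_of_ne_zero h)
        _ ≤ ∑ i, y i * a i :=
          Finset.single_le_sum (f := fun i => y i * a i) (fun _ _ => Nat.zero_le _)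
            (Finset.mem_univ i)
        _ = x := hy.symm
  · rw [hy]
    refine Finset.sum_congr rfl fun i _ => ?_
    by_cases h : a i = 0 <;> simp [h]

/-- The conductor of a numerical semigroup whose `k` generators are at most `M` is at most
`k * M * M`. -/
theorem mem_closure_range_of_le {k M : ℕ} {a : Fin k → ℕ} (ha : ∀ i, a i ≤ M) {G : ℕ}
    (hG : ∀ m, G ≤ m → m ∈ AddSubmonoid.closure (Set.range a)) {m : ℕ} (hm : k * M * M ≤ m) :
    m ∈ AddSubmonoid.closure (Set.range a) := by
  obtain ⟨y₀, hy₀⟩ := (mem_closure_range_nat_iff a _).1 (hG (G + 1) (by omega))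
  obtain ⟨j, hj⟩ : ∃ j, 0 < a j := by
    by_contra! h
    have : ∑ i, y₀ i * a i = 0 :=
      Finset.sum_eq_zero fun i _ => by simp [Nat.le_zero.1 (h i)]
    omega
  obtain ⟨y, hy⟩ := (mem_closure_range_nat_iff a _).1
    (hG (m + a j * G) (by nlinarith [Nat.zero_le m]))
  have hle : ∑ i, y i % a j * a i ≤ m := by
    calc ∑ i, y i % a j * a i ≤ ∑ _i : Fin k, M * M :=
          Finset.sum_le_sum fun i _ =>
            Nat.mul_le_mul ((Nat.mod_lt _ hj).le.trans (ha j)) (ha i)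
      _ = k * M * M := by simp [mul_assoc]
      _ ≤ m := hm
  have hmod : ∑ i, y i % a j * a i ≡ m [MOD a j] := by
    calc ∑ i, y i % a j * a i ≡ ∑ i, y i * a i [MOD a j] := by
          refine Nat.ModEq.sum fun i _ => ?_
          exact (Nat.mod_modEq _ _).mul_right _
      _ = m + a j * G := hy.symm
      _ ≡ m [MOD a j] := by simp [Nat.ModEq]
  obtain ⟨c, hc⟩ := (Nat.modEq_iff_dvd' hle).1 hmod
  have hmem : ∑ i, y i % a j * a i ∈ AddSubmonoid.closure (Set.range a) :=
    (mem_closure_range_nat_iff a _).2 ⟨_, rfl⟩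
  have hmul : c • a j ∈ AddSubmonoid.closure (Set.range a) :=
    AddSubmonoid.nsmul_mem _ (AddSubmonoid.subset_closure (Set.mem_range_self j)) c
  have hadd := AddSubmonoid.add_mem _ hmem hmul
  have : ∑ i, y i % a j * a i + c • a j = m := by
    rw [smul_eq_mul, mul_comm c, ← hc]; omega
  rwa [this] at hadd

/-- The matrix of the sentence expressing that `S` is an irreducible numerical semigroup. -/
def SymmetryMatrix (S : AddSubmonoid ℕ) (G x y : ℕ) : Prop :=
  (x + 1 = G → x ∉ S) ∧ G + x ∈ S ∧ (x + y + 1 = G → x ∈ S ∨ y ∈ S ∨ x = y)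

theorem isIrredNumSemigroup_closure_range_iff {k M B : ℕ} {a : Fin k → ℕ} (ha : ∀ i, a i ≤ M)
    (hB : k * M * M < B) (hMB : M ≤ B) (hB2 : 2 ≤ B) :
    IsIrredNumSemigroup (AddSubmonoid.closure (Set.range a)) ↔
      ∃ G < B, ∀ x < B, ∀ y < B,
        SymmetryMatrix (AddSubmonoid.closure (Set.range a)) G x y := by
  constructor
  · intro h
    obtain ⟨G, h₁, h₂, h₃⟩ := h.exists_isSymmetricConductor
    refine ⟨G, ?_, fun x _ y _ => ⟨h₁ x, h₂ _ (Nat.le_add_right _ _), h₃ x y⟩⟩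
    by_contra! hlt
    exact h₁ (G - 1) (by omega) (mem_closure_range_of_le ha h₂ (by omega))
  · rintro ⟨G, hGB, h⟩
    have hmem : ∀ x < B, G + x ∈ AddSubmonoid.closure (Set.range a) := fun x hx =>
      (h x hx x hx).2.1
    obtain ⟨y₀, hy₀⟩ := (mem_closure_range_nat_iff a _).1 (hmem 1 (by omega))
    obtain ⟨j, hj⟩ : ∃ j, 0 < a j := by
      by_contra! h
      have : ∑ i, y₀ i * a i = 0 :=
        Finset.sum_eq_zero fun i _ => by simp [Nat.le_zero.1 (h i)]
      omega
    have hjM := ha j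
    refine IsSymmetricConductor.isIrredNumSemigroup (G := G)
      ⟨fun z hz => (h z (by omega) z (by omega)).1 hz, fun m => ?_,
        fun x y hxy => (h x (by omega) y (by omega)).2.2 hxy⟩
    induction m using Nat.strong_induction_on with
    | _ m ih =>
      intro hm
      by_cases hlt : m < G + B
      · have := hmem (m - G) (by omega)
        rwa [Nat.add_sub_cancel' hm] at this
      · have := AddSubmonoid.add_mem _ (ih (m - a j) (by omega) (by omega))
          (AddSubmonoid.subset_closure (Set.mem_range_self j))
        rwa [Nat.sub_add_cancel (by omega)] at this

theorem Polynomial.exists_abs_eval_le_pow (p : Polynomial ℤ) :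
    ∃ E N : ℕ, ∀ n : ℕ, N ≤ n → |p.eval (n : ℤ)| ≤ (n : ℤ) ^ E := by
  induction p using Polynomial.induction_on with
  | C c =>
    refine ⟨1, c.natAbs, fun n hn => ?_⟩
    rw [Polynomial.eval_C, pow_one, Int.abs_eq_natAbs]
    exact_mod_cast hn
  | add p q hp hq =>
    obtain ⟨E₁, N₁, h₁⟩ := hp
    obtain ⟨E₂, N₂, h₂⟩ := hq
    refine ⟨max E₁ E₂ + 1, max (max N₁ N₂) 2, fun n hn => ?_⟩
    have hn2 : (2 : ℤ) ≤ n := by exact_mod_cast (le_max_right _ _).trans hn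
    have hn1 : (1 : ℤ) ≤ n := by linarith
    have e₁ := h₁ n ((le_max_left _ _).trans ((le_max_left _ _).trans hn))
    have e₂ := h₂ n ((le_max_right _ _).trans ((le_max_left _ _).trans hn))
    have f₁ : (n : ℤ) ^ E₁ ≤ n ^ max E₁ E₂ := pow_le_pow_right₀ hn1 (le_max_left _ _)
    have f₂ : (n : ℤ) ^ E₂ ≤ n ^ max E₁ E₂ := pow_le_pow_right₀ hn1 (le_max_right _ _)
    have hpos : (0 : ℤ) ≤ n ^ max E₁ E₂ := by positivity
    rw [Polynomial.eval_add, pow_succ]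
    refine (abs_add_le _ _).trans ?_
    nlinarith
  | monomial m c h =>
    obtain ⟨E, N, h⟩ := h
    refine ⟨E + 1, N, fun n hn => ?_⟩
    have := h n hn
    rw [pow_succ (Polynomial.X), ← mul_assoc, Polynomial.eval_mul_X, abs_mul, pow_succ,
      Nat.abs_cast]
    exact mul_le_mul_of_nonneg_right this (Nat.cast_nonneg n)

theorem exists_forall_le_pow {k : ℕ} {f : Fin k → ℕ → ℕ}
    (hf : ∀ i, ∃ p : Polynomial ℤ, ∀ n : ℕ, (f i n : ℤ) = p.eval (n : ℤ)) :
    ∃ E N : ℕ, ∀ n : ℕ, N ≤ n → ∀ i, f i n ≤ n ^ E := by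
  choose p hp using hf
  choose E N h using fun i => (p i).exists_abs_eval_le_pow
  refine ⟨Finset.univ.sup E, Finset.univ.sup N + 1, fun n hn i => ?_⟩
  have hN : N i ≤ n := (Finset.le_sup (Finset.mem_univ i)).trans (by omega)
  have h₁ : (f i n : ℤ) ≤ (n : ℤ) ^ E i := by
    rw [hp]; exact (le_abs_self _).trans (h i n hN)
  have h₂ : f i n ≤ n ^ E i := by exact_mod_cast h₁
  exact h₂.trans (Nat.pow_le_pow_right (by omega) (Finset.le_sup (Finset.mem_univ i)))

/-! ### Semilinear sets of digit vectors -/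

section Digits

variable {ι μ : Type*}

/-- The coordinate `i₀` of `v` is at least `N` and strictly bounds all the other ones. -/
def DigitBounded (N : ℕ) (i₀ : ι) (v : ι → ℕ) : Prop :=
  N ≤ v i₀ ∧ ∀ i, i ≠ i₀ → v i < v i₀

theorem digitBounded_sumElim_iff {N : ℕ} {i₀ : ι} {v : ι → ℕ} {w : μ → ℕ} :
    DigitBounded N (Sum.inl i₀) (Sum.elim v w) ↔ DigitBounded N i₀ v ∧ ∀ j, w j < v i₀ := by
  simp [DigitBounded, and_assoc]

/-- The predicate `P` is semilinear on digit-bounded vectors. -/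
def DigitSemilinear (N : ℕ) (i₀ : ι) (P : (ι → ℕ) → Prop) : Prop :=
  IsSemilinearSet {v : ι → ℕ | DigitBounded N i₀ v ∧ P v}

namespace DigitSemilinear

variable {N : ℕ} {i₀ : ι} {P Q : (ι → ℕ) → Prop}

theorem congr (h : ∀ v, DigitBounded N i₀ v → (P v ↔ Q v)) (hP : DigitSemilinear N i₀ P) :
    DigitSemilinear N i₀ Q := by
  unfold DigitSemilinear at *
  convert hP using 1
  ext v
  exact and_congr_right fun hv => (h v hv).symm

theorem and (hP : DigitSemilinear N i₀ P) (hQ : DigitSemilinear N i₀ Q) :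
    DigitSemilinear N i₀ fun v => P v ∧ Q v := by
  have h := IsSemilinearSet.inter hP hQ
  unfold DigitSemilinear
  convert h using 1
  ext v
  simp only [Set.mem_ofPred_eq, Set.mem_inter_iff]
  tauto

theorem exists_digits {P : (ι → ℕ) → (μ → ℕ) → Prop}
    (hP : DigitSemilinear N (Sum.inl i₀ : ι ⊕ μ) fun u => P (u ∘ Sum.inl) (u ∘ Sum.inr)) :
    DigitSemilinear N i₀ fun v => ∃ w : μ → ℕ, (∀ j, w j < v i₀) ∧ P v w := by
  have h := IsSemilinearSet.proj hP
  unfold DigitSemilinear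
  convert h using 1
  ext v
  simp only [Set.mem_ofPred_eq, digitBounded_sumElim_iff, Sum.elim_comp_inl, Sum.elim_comp_inr,
    and_assoc, exists_and_left]

end DigitSemilinear

variable [Fintype ι] [Fintype μ]

/-- The affine form with constant term `c.1` and coefficients `c.2`. -/
def affineForm (c : ℤ × (ι → ℤ)) (v : ι → ℕ) : ℤ := c.1 + ∑ i, c.2 i * v i

theorem isSemilinearSet_affineForm_eq_zero (c : ℤ × (ι → ℤ)) :
    IsSemilinearSet {v : ι → ℕ | affineForm c v = 0} := by
  let φ : (ι → ℕ) →+ ℤ :=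
    { toFun := fun v => ∑ i, c.2 i * v i
      map_zero' := by simp
      map_add' := fun v w => by simp [mul_add, Finset.sum_add_distrib] }
  simpa [affineForm, φ] using isSemilinearSet_setOfPred_eq c.1 0 φ (0 : (ι → ℕ) →+ ℤ)

theorem isSemilinearSet_affineForm_nonneg (c : ℤ × (ι → ℤ)) :
    IsSemilinearSet {v : ι → ℕ | 0 ≤ affineForm c v} := by
  have h := (isSemilinearSet_affineForm_eq_zero (ι := ι ⊕ Unit)
    (c.1, Sum.elim c.2 fun _ => -1)).proj
  convert h using 1
  ext v
  simp only [affineForm, Set.mem_ofPred_eq, Fintype.sum_sum_type, Sum.elim_inl, Sum.elim_inr,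
    Finset.univ_unique, Finset.sum_singleton]
  constructor
  · intro h
    exact ⟨fun _ => (c.1 + ∑ i, c.2 i * (v i : ℤ)).toNat, by rw [Int.toNat_of_nonneg h]; ring⟩
  · rintro ⟨y, hy⟩
    have := Int.natCast_nonneg (y default)
    linarith

theorem isSemilinearSet_digitBounded (N : ℕ) (i₀ : ι) :
    IsSemilinearSet {v : ι → ℕ | DigitBounded N i₀ v} := by
  classical
  have h₁ := isSemilinearSet_affineForm_nonneg (ι := ι) (-(N : ℤ), Pi.single i₀ 1)
  have h₂ : ∀ i, IsSemilinearSet {v : ι → ℕ | i ≠ i₀ → v i < v i₀} := fun i => by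
    by_cases hi : i = i₀
    · simp [hi]
    · convert isSemilinearSet_affineForm_nonneg (ι := ι) (-1, Pi.single i₀ 1 - Pi.single i 1)
        using 1
      ext v
      simp [affineForm, hi, sub_mul, Finset.sum_sub_distrib, Pi.single_apply]
      omega
  convert h₁.inter (IsSemilinearSet.iInter h₂) using 1
  ext v
  simp [DigitBounded, affineForm, Pi.single_apply]

namespace DigitSemilinear

variable {N : ℕ} {i₀ : ι} {P Q : (ι → ℕ) → Prop}

theorem not (hP : DigitSemilinear N i₀ P) : DigitSemilinear N i₀ fun v => ¬ P v := by
  have h := (isSemilinearSet_digitBounded N i₀).inter (IsSemilinearSet.compl hP)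
  unfold DigitSemilinear
  convert h using 1
  ext v
  simp only [Set.mem_ofPred_eq, Set.mem_inter_iff, Set.mem_compl_iff]
  tauto

theorem or (hP : DigitSemilinear N i₀ P) (hQ : DigitSemilinear N i₀ Q) :
    DigitSemilinear N i₀ fun v => P v ∨ Q v :=
  (hP.not.and hQ.not).not.congr fun v _ => by tauto

theorem imp (hP : DigitSemilinear N i₀ P) (hQ : DigitSemilinear N i₀ Q) :
    DigitSemilinear N i₀ fun v => P v → Q v :=
  (hP.and hQ.not).not.congr fun v _ => by tauto

theorem forall_digits {P : (ι → ℕ) → (μ → ℕ) → Prop}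
    (hP : DigitSemilinear N (Sum.inl i₀ : ι ⊕ μ) fun u => P (u ∘ Sum.inl) (u ∘ Sum.inr)) :
    DigitSemilinear N i₀ fun v => ∀ w : μ → ℕ, (∀ j, w j < v i₀) → P v w :=
  (exists_digits (P := fun v w => ¬ P v w) hP.not).not.congr fun v _ => by
    simp only [not_exists, not_and, not_not]

end DigitSemilinear

/-! ### Polynomial combinations of digits -/

/-- Horner evaluation at `v i₀` of the polynomial whose coefficients are affine forms in `v`. -/
def hornerForm (i₀ : ι) : List (ℤ × (ι → ℤ)) → (ι → ℕ) → ℤ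
  | [], _ => 0
  | c :: l, v => affineForm c v + v i₀ * hornerForm i₀ l v

theorem affineForm_add (c d : ℤ × (ι → ℤ)) (v : ι → ℕ) :
    affineForm (c + d) v = affineForm c v + affineForm d v := by
  simp only [affineForm, Prod.fst_add, Prod.snd_add, Pi.add_apply, add_mul,
    Finset.sum_add_distrib]
  ring

theorem affineForm_smul (r : ℤ) (c : ℤ × (ι → ℤ)) (v : ι → ℕ) :
    affineForm (r • c) v = r * affineForm c v := by
  simp [affineForm, mul_add, Finset.mul_sum, mul_assoc]

/-- The functions of the form `∑ j, (v i₀) ^ j * L j v` with `L j` affine forms. -/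
def digitTerms (i₀ : ι) : Submodule ℤ ((ι → ℕ) → ℤ) where
  carrier := Set.range (hornerForm i₀)
  zero_mem' := ⟨[], rfl⟩
  add_mem' := by
    rintro _ _ ⟨l, rfl⟩ ⟨m, rfl⟩
    induction l generalizing m with
    | nil => exact ⟨m, by ext v; simp [hornerForm]⟩
    | cons c l ih =>
      cases m with
      | nil => exact ⟨c :: l, by ext v; simp [hornerForm]⟩
      | cons d m =>
        obtain ⟨t, ht⟩ := ih m
        refine ⟨(c + d) :: t, ?_⟩
        ext v
        simp only [hornerForm, Pi.add_apply, affineForm_add, ht]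
        ring
  smul_mem' := by
    rintro r _ ⟨l, rfl⟩
    induction l with
    | nil => exact ⟨[], by ext v; simp [hornerForm]⟩
    | cons c l ih =>
      obtain ⟨t, ht⟩ := ih
      refine ⟨(r • c) :: t, ?_⟩
      ext v
      simp only [hornerForm, Pi.smul_apply, smul_eq_mul, affineForm_smul, ht]
      ring

theorem const_mem_digitTerms (i₀ : ι) (c : ℤ) : (fun _ => c) ∈ digitTerms i₀ :=
  ⟨[(c, 0)], by ext v; simp [hornerForm, affineForm]⟩

theorem coord_mem_digitTerms (i₀ i : ι) : (fun v => (v i : ℤ)) ∈ digitTerms i₀ := by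
  classical
  exact ⟨[(0, Pi.single i 1)], by ext v; simp [hornerForm, affineForm, Pi.single_apply]⟩

theorem base_mul_mem_digitTerms {i₀ : ι} {g : (ι → ℕ) → ℤ} (hg : g ∈ digitTerms i₀) :
    (fun v => (v i₀ : ℤ) * g v) ∈ digitTerms i₀ := by
  obtain ⟨l, rfl⟩ := hg
  exact ⟨(0, 0) :: l, by ext v; simp [hornerForm, affineForm]⟩

theorem polynomial_mul_mem_digitTerms {i₀ : ι} {g : (ι → ℕ) → ℤ} (hg : g ∈ digitTerms i₀)
    (p : Polynomial ℤ) : (fun v => p.eval (v i₀ : ℤ) * g v) ∈ digitTerms i₀ := by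
  induction p using Polynomial.induction_on with
  | C c => simpa [Pi.smul_def] using (digitTerms i₀).smul_mem c hg
  | add p q hp hq => simpa [add_mul, Pi.add_def] using (digitTerms i₀).add_mem hp hq
  | monomial m c h =>
    convert base_mul_mem_digitTerms h using 2 with v
    simp only [Polynomial.eval_mul, Polynomial.eval_C, Polynomial.eval_pow, Polynomial.eval_X]
    ring

theorem comp_inl_mem_digitTerms {i₀ : ι} {g : (ι → ℕ) → ℤ} (hg : g ∈ digitTerms i₀) :
    (fun u : ι ⊕ μ → ℕ => g (u ∘ Sum.inl)) ∈ digitTerms (Sum.inl i₀ : ι ⊕ μ) := by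
  obtain ⟨l, rfl⟩ := hg
  induction l with
  | nil => exact (digitTerms _).zero_mem
  | cons c l ih =>
    obtain ⟨t, ht⟩ := ih
    refine ⟨(c.1, Sum.elim c.2 0) :: t, ?_⟩
    ext u
    simp [hornerForm, affineForm, ht]

theorem abs_affineForm_le {i₀ : ι} {v : ι → ℕ} (hv : DigitBounded 1 i₀ v) (c : ℤ × (ι → ℤ)) :
    |affineForm c v| ≤ (|c.1| + ∑ i, |c.2 i|) * v i₀ := by
  have h1 : (1 : ℤ) ≤ v i₀ := by exact_mod_cast hv.1
  rw [add_mul, Finset.sum_mul]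
  refine (abs_add_le _ _).trans (add_le_add ?_ ((Finset.abs_sum_le_sum_abs _ _).trans ?_))
  · exact le_mul_of_one_le_right (abs_nonneg _) h1
  · refine Finset.sum_le_sum fun i _ => ?_
    rw [abs_mul, Nat.abs_cast]
    refine mul_le_mul_of_nonneg_left ?_ (abs_nonneg _)
    by_cases hi : i = i₀
    · rw [hi]
    · exact_mod_cast (hv.2 i hi).le

/-- Equations between polynomial combinations of digits are semilinear: the carries in base `v i₀`
take only finitely many values. -/
theorem digitSemilinear_hornerForm_eq_zero {N : ℕ} (hN : 1 ≤ N) (i₀ : ι)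
    (l : List (ℤ × (ι → ℤ))) (e : ℤ) :
    DigitSemilinear N i₀ fun v => e + hornerForm i₀ l v = 0 := by
  classical
  induction l generalizing e with
  | nil =>
    have h := (isSemilinearSet_digitBounded N i₀).inter
      (isSemilinearSet_affineForm_eq_zero (ι := ι) (e, 0))
    simpa [DigitSemilinear, affineForm, hornerForm, Set.inter_def] using h
  | cons c l ih =>
    let c' : ℤ × (ι → ℤ) := (e, 0) + c
    let C : ℤ := |c'.1| + ∑ i, |c'.2 i|
    have h : ∀ q : ℤ, IsSemilinearSet
        ({v : ι → ℕ | affineForm (c' + (0, Pi.single i₀ (-q))) v = 0} ∩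
          {v | DigitBounded N i₀ v ∧ q + hornerForm i₀ l v = 0}) := fun q =>
      (isSemilinearSet_affineForm_eq_zero _).inter (ih q)
    have hU := IsSemilinearSet.biUnion_finset (s := Finset.Icc (-C) C) fun q _ => h q
    unfold DigitSemilinear
    convert hU using 1
    ext v
    have e₁ : affineForm c' v = e + affineForm c v := by
      rw [affineForm_add]; simp [affineForm]
    have e₂ : ∀ q : ℤ, affineForm (c' + (0, Pi.single i₀ (-q))) v
        = e + affineForm c v - q * v i₀ := fun q => by
      rw [affineForm_add, e₁]; simp [affineForm, Pi.single_apply]; ring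
    simp only [Set.mem_ofPred_eq, Set.mem_iUnion, Set.mem_inter_iff, Finset.mem_Icc, e₂,
      hornerForm, exists_prop]
    constructor
    · rintro ⟨hv, hz⟩
      have hv1 : DigitBounded 1 i₀ v := ⟨hN.trans hv.1, hv.2⟩
      have hpos : (0 : ℤ) < v i₀ := by exact_mod_cast hv1.1
      have hb := abs_affineForm_le hv1 c'
      have heq : affineForm c' v = -hornerForm i₀ l v * v i₀ := by rw [e₁]; linarith
      rw [heq, abs_mul, Nat.abs_cast] at hb
      have hq := abs_le.1 (le_of_mul_le_mul_right hb hpos)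
      exact ⟨-hornerForm i₀ l v, hq, by linarith, hv, by ring⟩
    · rintro ⟨q, -, hq, hv, hz⟩
      have : hornerForm i₀ l v = -q := by linarith
      exact ⟨hv, by rw [this]; linarith⟩

theorem digitSemilinear_eq {N : ℕ} (hN : 1 ≤ N) {i₀ : ι} {g h : (ι → ℕ) → ℤ}
    (hg : g ∈ digitTerms i₀) (hh : h ∈ digitTerms i₀) :
    DigitSemilinear N i₀ fun v => g v = h v := by
  obtain ⟨l, hl⟩ := (digitTerms i₀).sub_mem hg hh
  refine (digitSemilinear_hornerForm_eq_zero hN i₀ l 0).congr fun v _ => ?_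
  rw [hl, Pi.sub_apply, zero_add, sub_eq_zero]

/-- The number with base `n` digits `d`. -/
def digitValue {D : ℕ} (n : ℕ) (d : Fin D → ℕ) : ℕ := ∑ j, d j * n ^ (j : ℕ)

theorem digitValue_lt {D n : ℕ} {d : Fin D → ℕ} (hd : ∀ j, d j < n) : digitValue n d < n ^ D := by
  have := (finFunctionFinEquiv fun j => (⟨d j, hd j⟩ : Fin n)).2
  rwa [finFunctionFinEquiv_apply] at this

theorem exists_digitValue_eq {D n m : ℕ} (hm : m < n ^ D) :
    ∃ d : Fin D → ℕ, (∀ j, d j < n) ∧ digitValue n d = m := by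
  refine ⟨fun j => finFunctionFinEquiv.symm ⟨m, hm⟩ j, fun j => Fin.is_lt _, ?_⟩
  have := congrArg Fin.val (finFunctionFinEquiv.apply_symm_apply (⟨m, hm⟩ : Fin (n ^ D)))
  rwa [finFunctionFinEquiv_apply] at this

theorem digitValue_mem_digitTerms {D : ℕ} (i₀ : ι) (c : Fin D → ι) :
    (fun v => (digitValue (v i₀) (v ∘ c) : ℤ)) ∈ digitTerms i₀ := by
  have : (fun v : ι → ℕ => (digitValue (v i₀) (v ∘ c) : ℤ))
      = ∑ j : Fin D, fun v => (Polynomial.X ^ (j : ℕ) : Polynomial ℤ).eval (v i₀ : ℤ) * (v (c j) : ℤ) := by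
    ext v
    simp [digitValue, Finset.sum_apply, mul_comm]
  rw [this]
  exact Submodule.sum_mem _ fun j _ => polynomial_mul_mem_digitTerms (coord_mem_digitTerms i₀ _) _

end Digits

/-! ### The irreducibility sentence -/

section Irreducible

variable {k : ℕ} {f : Fin k → ℕ → ℕ}

theorem digitSemilinear_mem_closure {ι : Type*} [Fintype ι]
    (hf : ∀ i, ∃ p : Polynomial ℤ, ∀ n : ℕ, (f i n : ℤ) = p.eval (n : ℤ)) {N : ℕ} (hN : 1 ≤ N)
    (E : ℕ) {i₀ : ι} {g : (ι → ℕ) → ℕ} (hg : (fun v => (g v : ℤ)) ∈ digitTerms i₀)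
    (hE : ∀ v, DigitBounded N i₀ v → g v < v i₀ ^ E) :
    DigitSemilinear N i₀ fun v => g v ∈ AddSubmonoid.closure (Set.range fun i => f i (v i₀)) := by
  choose p hp using hf
  have hterm : (fun u : ι ⊕ Fin k × Fin E → ℕ =>
      ∑ i, (p i).eval (u (Sum.inl i₀) : ℤ) *
        (digitValue (u (Sum.inl i₀)) (u ∘ fun j => Sum.inr (i, j)) : ℤ)) ∈
      digitTerms (Sum.inl i₀ : ι ⊕ Fin k × Fin E) := by
    rw [← Finset.sum_fn]
    exact Submodule.sum_mem _ fun i _ =>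
      polynomial_mul_mem_digitTerms (digitValue_mem_digitTerms _ _) _
  refine (DigitSemilinear.exists_digits
    (P := fun v w => (g v : ℤ) = ∑ i, (p i).eval (v i₀ : ℤ) *
      (digitValue (v i₀) (fun j => w (i, j)) : ℤ))
    (digitSemilinear_eq hN (comp_inl_mem_digitTerms hg) hterm)).congr fun v hv => ?_
  simp only [← hp]
  constructor
  · rintro ⟨w, -, hw⟩
    refine (mem_closure_range_nat_iff _ _).2 ⟨fun i => digitValue (v i₀) fun j => w (i, j), ?_⟩
    have : g v = ∑ i, f i (v i₀) * digitValue (v i₀) fun j => w (i, j) := by exact_mod_cast hw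
    rw [this]
    exact Finset.sum_congr rfl fun i _ => mul_comm _ _
  · intro hmem
    obtain ⟨y, hy, hsum⟩ := exists_le_of_mem_closure_range hmem
    choose d hd hdy using fun i => exists_digitValue_eq ((hy i).trans_lt (hE v hv))
    refine ⟨fun q => d q.1 q.2, fun q => hd _ _, ?_⟩
    simp only [hdy]
    rw [hsum]
    push_cast
    exact Finset.sum_congr rfl fun i _ => mul_comm _ _

theorem digitSemilinear_symmetryMatrix {ι : Type*} [Fintype ι]
    (hf : ∀ i, ∃ p : Polynomial ℤ, ∀ n : ℕ, (f i n : ℤ) = p.eval (n : ℤ)) {N D : ℕ}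
    (hN : 2 ≤ N) {i₀ : ι} {a b c : Fin D → ι} (ha : ∀ j, a j ≠ i₀) (hb : ∀ j, b j ≠ i₀)
    (hc : ∀ j, c j ≠ i₀) :
    DigitSemilinear N i₀ fun v =>
      SymmetryMatrix (AddSubmonoid.closure (Set.range fun i => f i (v i₀)))
        (digitValue (v i₀) (v ∘ a)) (digitValue (v i₀) (v ∘ b)) (digitValue (v i₀) (v ∘ c)) := by
  have hN1 : 1 ≤ N := by omega
  have hG := digitValue_mem_digitTerms i₀ a
  have hx := digitValue_mem_digitTerms i₀ b
  have hy := digitValue_mem_digitTerms i₀ c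
  have h1 := const_mem_digitTerms i₀ 1
  have hlt : ∀ {e : Fin D → ι}, (∀ j, e j ≠ i₀) → ∀ v, DigitBounded N i₀ v →
      digitValue (v i₀) (v ∘ e) < v i₀ ^ D := fun he v hv =>
    digitValue_lt fun j => hv.2 _ (he j)
  have hx1 : DigitSemilinear N i₀ fun v =>
      digitValue (v i₀) (v ∘ b) + 1 = digitValue (v i₀) (v ∘ a) :=
    (digitSemilinear_eq hN1 ((digitTerms i₀).add_mem hx h1) hG).congr fun v _ => by
      simp only [Pi.add_apply]; norm_cast
  have hxy1 : DigitSemilinear N i₀ fun v =>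
      digitValue (v i₀) (v ∘ b) + digitValue (v i₀) (v ∘ c) + 1 = digitValue (v i₀) (v ∘ a) :=
    (digitSemilinear_eq hN1 ((digitTerms i₀).add_mem ((digitTerms i₀).add_mem hx hy) h1)
      hG).congr fun v _ => by simp only [Pi.add_apply]; norm_cast
  have hxy : DigitSemilinear N i₀ fun v =>
      digitValue (v i₀) (v ∘ b) = digitValue (v i₀) (v ∘ c) :=
    (digitSemilinear_eq hN1 hx hy).congr fun v _ => Nat.cast_inj
  have hGx : DigitSemilinear N i₀ fun v =>
      digitValue (v i₀) (v ∘ a) + digitValue (v i₀) (v ∘ b) ∈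
        AddSubmonoid.closure (Set.range fun i => f i (v i₀)) := by
    refine digitSemilinear_mem_closure hf hN1 (D + 1) ?_ fun v hv => ?_
    · simpa [Pi.add_def] using (digitTerms i₀).add_mem hG hx
    · have h₁ := hlt ha v hv
      have h₂ := hlt hb v hv
      have h₃ : v i₀ ^ D * 2 ≤ v i₀ ^ (D + 1) := by
        rw [pow_succ]; exact Nat.mul_le_mul_left _ (hN.trans hv.1)
      omega
  have hxS := digitSemilinear_mem_closure hf hN1 D hx (hlt hb)
  have hyS := digitSemilinear_mem_closure hf hN1 D hy (hlt hc)
  exact (hx1.imp hxS.not).and (hGx.and (hxy1.imp (hxS.or (hyS.or hxy))))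

theorem digitSemilinear_exists_forall_symmetryMatrix
    (hf : ∀ i, ∃ p : Polynomial ℤ, ∀ n : ℕ, (f i n : ℤ) = p.eval (n : ℤ)) {N : ℕ}
    (hN : 2 ≤ N) (D : ℕ) :
    DigitSemilinear N () fun v : Unit → ℕ => ∃ G < v () ^ D, ∀ x < v () ^ D, ∀ y < v () ^ D,
      SymmetryMatrix (AddSubmonoid.closure (Set.range fun i => f i (v ()))) G x y := by
  have hM := digitSemilinear_symmetryMatrix (ι := (Unit ⊕ Fin D) ⊕ (Fin D ⊕ Fin D)) hf hN
    (i₀ := Sum.inl (Sum.inl ())) (a := fun j => Sum.inl (Sum.inr j))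
    (b := fun j => Sum.inr (Sum.inl j)) (c := fun j => Sum.inr (Sum.inr j))
    (by simp) (by simp) (by simp)
  have hA := DigitSemilinear.forall_digits (i₀ := (Sum.inl () : Unit ⊕ Fin D))
    (P := fun u w => SymmetryMatrix
      (AddSubmonoid.closure (Set.range fun i => f i (u (Sum.inl ()))))
      (digitValue (u (Sum.inl ())) (u ∘ Sum.inr))
      (digitValue (u (Sum.inl ())) (w ∘ Sum.inl))
      (digitValue (u (Sum.inl ())) (w ∘ Sum.inr))) hM
  refine (DigitSemilinear.exists_digits (i₀ := ())
    (P := fun v d => ∀ w : Fin D ⊕ Fin D → ℕ, (∀ j, w j < v ()) → SymmetryMatrix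
      (AddSubmonoid.closure (Set.range fun i => f i (v ())))
      (digitValue (v ()) d) (digitValue (v ()) (w ∘ Sum.inl))
      (digitValue (v ()) (w ∘ Sum.inr))) hA).congr fun v _ => ?_
  constructor
  · rintro ⟨d, hd, h⟩
    refine ⟨_, digitValue_lt hd, fun x hx y hy => ?_⟩
    obtain ⟨dx, hdx, rfl⟩ := exists_digitValue_eq hx
    obtain ⟨dy, hdy, rfl⟩ := exists_digitValue_eq hy
    exact h (Sum.elim dx dy) (by rintro (j | j) <;> simp [hdx, hdy])
  · rintro ⟨G, hG, h⟩
    obtain ⟨d, hd, rfl⟩ := exists_digitValue_eq hG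
    exact ⟨d, hd, fun w hw => h _ (digitValue_lt fun j => hw _) _ (digitValue_lt fun j => hw _)⟩

end Irreducible

theorem stmt6 (k : ℕ) (hk : 1 ≤ k) (f : Fin k → ℕ → ℕ)
    (hf : ∀ i, ∃ p : Polynomial ℤ, ∀ n : ℕ, (f i n : ℤ) = p.eval (n : ℤ)) :
    EvPeriodicSet {n : ℕ |
      ((SG k f n : Set ℕ)ᶜ).Finite ∧
      ¬ ∃ T₁ T₂ : AddSubmonoid ℕ,
          ((T₁ : Set ℕ)ᶜ).Finite ∧ ((T₂ : Set ℕ)ᶜ).Finite ∧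
          SG k f n < T₁ ∧ SG k f n < T₂ ∧ SG k f n = T₁ ⊓ T₂} := by
  obtain ⟨E, N₀, hE⟩ := exists_forall_le_pow hf
  let N := N₀ + k + 2
  let D := E + E + 1
  have hirr : ∀ n, N ≤ n → (IsIrredNumSemigroup (SG k f n) ↔
      ∃ G < n ^ D, ∀ x < n ^ D, ∀ y < n ^ D, SymmetryMatrix (SG k f n) G x y) := by
    intro n hn
    have hkn : k < n := by omega
    have hn2 : 2 ≤ n := by omega
    refine isIrredNumSemigroup_closure_range_iff (hE n (by omega)) ?_ ?_ ?_
    · rw [mul_assoc, ← pow_add, pow_succ, mul_comm]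
      exact Nat.mul_lt_mul_of_pos_left hkn (by positivity)
    · exact Nat.pow_le_pow_right (by omega) (by omega)
    · exact hn2.trans (Nat.le_self_pow (by omega) n)
  have hsemi := (digitSemilinear_exists_forall_symmetryMatrix hf (N := N) (by omega) D).image
    (LinearEquiv.funUnique Unit ℕ ℕ)
  obtain ⟨K, p, hp, hper⟩ := Nat.isSemilinearSet_iff_ultimately_periodic.1 hsemi
  have hmem : ∀ n, N ≤ n → (IsIrredNumSemigroup (SG k f n) ↔
      n ∈ LinearEquiv.funUnique Unit ℕ ℕ '' {v | DigitBounded N () v ∧ ∃ G < v () ^ D,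
        ∀ x < v () ^ D, ∀ y < v () ^ D,
          SymmetryMatrix (AddSubmonoid.closure (Set.range fun i => f i (v ()))) G x y}) := by
    intro n hn
    rw [hirr n hn]
    constructor
    · exact fun h => ⟨fun _ => n, ⟨⟨hn, by simp⟩, h⟩, rfl⟩
    · rintro ⟨v, ⟨-, h⟩, rfl⟩
      exact h
  refine ⟨max K N, p, hp, fun n hn => ?_⟩
  have hK : K ≤ n := (le_max_left _ _).trans hn
  have hN : N ≤ n := (le_max_right _ _).trans hn
  exact (hmem n hN).trans ((hper n hK).trans (hmem (n + p) (by omega)).symm)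
end

section
/- Let f_1, …, f_k : ℕ → ℕ be functions given by polynomials with integer coefficients, and for each n let S_n ⊆ ℕ be the additive submonoid generated by f_1(n), …, f_k(n). Then there is an eventually quasi-polynomial function g : ℕ → ℤ such that for every n for which the delta set Δ(S_n) is finite, |Δ(S_n)| = g(n). -/
/-- A function `c : ℕ → ℚ` is eventually periodic if there are `N` and `p ≥ 1`
with `c (n + p) = c n` for all `n ≥ N`. -/
def EvPeriodic (c : ℕ → ℚ) : Prop :=
  ∃ N p : ℕ, 1 ≤ p ∧ ∀ n, N ≤ n → c (n + p) = c n

/-- A function `g : ℕ → ℤ` is eventually quasi-polynomial if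
`g n = Σ_{i=0}^d c_i(n)·n^i` for eventually periodic `c_0, …, c_d : ℕ → ℚ`. -/
def IsEQP (g : ℕ → ℤ) : Prop :=
  ∃ (d : ℕ) (c : ℕ → ℕ → ℚ), (∀ i, i ≤ d → EvPeriodic (c i)) ∧
    ∀ n : ℕ, (g n : ℚ) = ∑ i ∈ Finset.range (d + 1), c i n * (n : ℚ) ^ i

/-- The length set of `m` in `SG k f n`: all sums `z 0 + … + z (k-1)` over
factorizations `Σ_i z i · f i n = m`. -/
def LSet (k : ℕ) (f : Fin k → ℕ → ℕ) (n m : ℕ) : Set ℕ :=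
  {ℓ : ℕ | ∃ z : Fin k → ℕ, (∑ i, z i * f i n) = m ∧ (∑ i, z i) = ℓ}

/-- The delta set of `m` in `SG k f n`: differences of consecutive elements of
the length set of `m`. -/
def DeltaSetOf (k : ℕ) (f : Fin k → ℕ → ℕ) (n m : ℕ) : Set ℕ :=
  {δ : ℕ | ∃ ℓ ℓ' : ℕ, ℓ ∈ LSet k f n m ∧ ℓ' ∈ LSet k f n m ∧ ℓ < ℓ' ∧
    δ = ℓ' - ℓ ∧ ∀ t ∈ LSet k f n m, ¬ (ℓ < t ∧ t < ℓ')}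

/-- The delta set of the semigroup `SG k f n`. -/
def BigDelta (k : ℕ) (f : Fin k → ℕ → ℕ) (n : ℕ) : Set ℕ :=
  ⋃ m ∈ (SG k f n : Set ℕ), DeltaSetOf k f n m

/-- Integer affine functions on `ι → ℤ`. -/
def affineFun (ι : Type*) : Submodule ℤ ((ι → ℤ) → ℤ) :=
  Submodule.span ℤ (insert 1 (Set.range fun (i : ι) (x : ι → ℤ) => x i))

section PiecewiseQuasiPolynomials

variable {ι : Type*}

theorem const_mem_affineFun (c : ℤ) : (fun _ => c) ∈ affineFun ι := by
  have h : (1 : (ι → ℤ) → ℤ) ∈ affineFun ι := Submodule.subset_span (Set.mem_insert _ _)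
  convert (affineFun ι).smul_mem c h using 1
  ext x; simp

theorem coord_mem_affineFun (i : ι) : (fun x : ι → ℤ => x i) ∈ affineFun ι :=
  Submodule.subset_span (Set.mem_insert_of_mem _ ⟨i, rfl⟩)

theorem mul_mem_affineFun (c : ℤ) {L : (ι → ℤ) → ℤ} (hL : L ∈ affineFun ι) :
    (fun x => c * L x) ∈ affineFun ι := (affineFun ι).smul_mem c hL

theorem add_mem_affineFun {L M : (ι → ℤ) → ℤ} (hL : L ∈ affineFun ι) (hM : M ∈ affineFun ι) :
    (fun x => L x + M x) ∈ affineFun ι := (affineFun ι).add_mem hL hM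

theorem sub_mem_affineFun {L M : (ι → ℤ) → ℤ} (hL : L ∈ affineFun ι) (hM : M ∈ affineFun ι) :
    (fun x => L x - M x) ∈ affineFun ι := (affineFun ι).sub_mem hL hM

/-- An affine function is split into its linear part in one coordinate and an affine function
of the other coordinates. -/
theorem exists_affineFun_split [DecidableEq ι] (j : ι) {L : (ι → ℤ) → ℤ} (hL : L ∈ affineFun ι) :
    ∃ (c : ℤ) (M : (ι → ℤ) → ℤ), M ∈ affineFun ι ∧ (∀ x t, M (Function.update x j t) = M x) ∧
      ∀ x, L x = c * x j + M x := by
  induction hL using Submodule.span_induction with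
  | mem L hL =>
    rcases hL with rfl | ⟨i, rfl⟩
    · exact ⟨0, fun _ => 1, const_mem_affineFun 1, by simp, by simp⟩
    · by_cases h : i = j
      · subst h
        exact ⟨1, fun _ => 0, const_mem_affineFun 0, by simp, by simp⟩
      · exact ⟨0, _, coord_mem_affineFun i, by simp [h], by simp⟩
  | zero => exact ⟨0, fun _ => 0, const_mem_affineFun 0, by simp, by simp⟩
  | add L L' _ _ h h' =>
    obtain ⟨c, M, hM, hi, he⟩ := h
    obtain ⟨c', M', hM', hi', he'⟩ := h'
    exact ⟨c + c', _, add_mem_affineFun hM hM', by simp [hi, hi'], fun x => by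
      simp only [Pi.add_apply, he, he']; ring⟩
  | smul a L _ h =>
    obtain ⟨c, M, hM, hi, he⟩ := h
    exact ⟨a * c, _, mul_mem_affineFun a hM, by simp [hi], fun x => by
      simp only [Pi.smul_apply, he, smul_eq_mul]; ring⟩

open Classical in
/-- The indicator function of a predicate. -/
noncomputable def ind {α : Type*} (P : α → Prop) (x : α) : ℚ := if P x then 1 else 0

theorem ind_pos {α : Type*} {P : α → Prop} {x : α} (h : P x) : ind P x = 1 := if_pos h

theorem ind_neg {α : Type*} {P : α → Prop} {x : α} (h : ¬ P x) : ind P x = 0 := if_neg h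

theorem ind_congr {α β : Type*} {P : α → Prop} {Q : β → Prop} {x : α} {y : β} (h : P x ↔ Q y) :
    ind P x = ind Q y := by
  by_cases hx : P x
  · rw [ind_pos hx, ind_pos (h.1 hx)]
  · rw [ind_neg hx, ind_neg (mt h.2 hx)]

/-- The algebra of piecewise quasi-polynomial functions, generated by affine functions and the
indicators of half-spaces and of linear congruences. -/
noncomputable def pqp (ι : Type*) : Subalgebra ℚ ((ι → ℤ) → ℚ) :=
  Algebra.adjoin ℚ {h | ∃ L ∈ affineFun ι, (h = fun x => (L x : ℚ)) ∨
    (h = ind fun x => 0 ≤ L x) ∨ ∃ m : ℕ, 0 < m ∧ h = ind fun x => (m : ℤ) ∣ L x}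

theorem cast_mem_pqp {L : (ι → ℤ) → ℤ} (hL : L ∈ affineFun ι) :
    (fun x => (L x : ℚ)) ∈ pqp ι :=
  Algebra.subset_adjoin ⟨L, hL, .inl rfl⟩

theorem halfSpace_mem_pqp {L : (ι → ℤ) → ℤ} (hL : L ∈ affineFun ι) :
    (ind fun x => 0 ≤ L x) ∈ pqp ι :=
  Algebra.subset_adjoin ⟨L, hL, .inr (.inl rfl)⟩

theorem congruence_mem_pqp {L : (ι → ℤ) → ℤ} (hL : L ∈ affineFun ι) {m : ℕ} (hm : 0 < m) :
    (ind fun x => (m : ℤ) ∣ L x) ∈ pqp ι :=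
  Algebra.subset_adjoin ⟨L, hL, .inr (.inr ⟨m, hm, rfl⟩)⟩

theorem not_mem_pqp {P : (ι → ℤ) → Prop} (h : ind P ∈ pqp ι) : (ind fun x => ¬ P x) ∈ pqp ι := by
  convert (pqp ι).sub_mem (pqp ι).one_mem h using 1
  ext x
  by_cases hx : P x <;> simp [ind, hx]

theorem and_mem_pqp {P Q : (ι → ℤ) → Prop} (hP : ind P ∈ pqp ι) (hQ : ind Q ∈ pqp ι) :
    (ind fun x => P x ∧ Q x) ∈ pqp ι := by
  convert (pqp ι).mul_mem hP hQ using 1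
  ext x
  by_cases hx : P x <;> by_cases hy : Q x <;> simp [ind, hx, hy]

theorem forall_mem_pqp {κ : Type*} [Finite κ] {P : κ → (ι → ℤ) → Prop}
    (hP : ∀ i, ind (P i) ∈ pqp ι) : (ind fun x => ∀ i, P i x) ∈ pqp ι := by
  have := Fintype.ofFinite κ
  classical
  convert (pqp ι).prod_mem (t := Finset.univ) fun i _ => hP i using 1
  ext x
  simp [Finset.prod_apply, ind, Finset.prod_ite_zero]

theorem exists_mem_pqp {κ : Type*} [Finite κ] {P : κ → (ι → ℤ) → Prop}
    (hP : ∀ i, ind (P i) ∈ pqp ι) : (ind fun x => ∃ i, P i x) ∈ pqp ι := by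
  convert not_mem_pqp (forall_mem_pqp fun i => not_mem_pqp (hP i)) using 3
  simp

theorem mem_pqp_of_residues {L : (ι → ℤ) → ℤ} (hL : L ∈ affineFun ι) {m : ℕ} (hm : 0 < m)
    {h : (ι → ℤ) → ℚ} (g : ℕ → (ι → ℤ) → ℚ) (hg : ∀ r < m, g r ∈ pqp ι)
    (hgh : ∀ r < m, ∀ x, (m : ℤ) ∣ L x - r → h x = g r x) : h ∈ pqp ι := by
  have key : h = ∑ r ∈ Finset.range m, (ind fun x => (m : ℤ) ∣ L x - r) * g r := by
    ext x
    have hm' : (0 : ℤ) < m := by exact_mod_cast hm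
    have h0 := Int.emod_nonneg (L x) hm'.ne'
    have h1 := Int.emod_lt_of_pos (L x) hm'
    obtain ⟨r, hr⟩ := Int.eq_ofNat_of_zero_le h0
    have hrm : r < m := by omega
    have hd : (m : ℤ) ∣ L x - r := by rw [← hr]; exact Int.dvd_self_sub_emod
    rw [Finset.sum_apply, Finset.sum_eq_single r]
    · simp [ind, hd, hgh r hrm x hd]
    · intro s hs hsr
      have : ¬ (m : ℤ) ∣ L x - s := by
        intro hd'
        have h2 : (m : ℤ) ∣ (r : ℤ) - s := by
          have := dvd_sub hd' hd
          rwa [sub_sub_sub_cancel_left] at this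
        have h3 := Int.eq_zero_of_abs_lt_dvd h2 (by
          rw [Finset.mem_range] at hs
          rw [abs_lt]; constructor <;> omega)
        omega
      simp [ind, this]
    · simp [hrm]
  rw [key]
  refine (pqp ι).sum_mem fun r hr => (pqp ι).mul_mem
    (congruence_mem_pqp (sub_mem_affineFun hL (const_mem_affineFun _)) hm) (hg r ?_)
  simpa using hr

/-- Membership in `pqp` is stable under a substitution that preserves it on the generators. -/
theorem comp_mem_pqp {κ : Type*} (φ : (κ → ℤ) → (ι → ℤ)) (B : Subalgebra ℚ ((κ → ℤ) → ℚ))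
    (h1 : ∀ L ∈ affineFun ι, (fun x => (L (φ x) : ℚ)) ∈ B)
    (h2 : ∀ L ∈ affineFun ι, (ind fun x => 0 ≤ L (φ x)) ∈ B)
    (h3 : ∀ L ∈ affineFun ι, ∀ m : ℕ, 0 < m → (ind fun x => (m : ℤ) ∣ L (φ x)) ∈ B)
    {h : (ι → ℤ) → ℚ} (hh : h ∈ pqp ι) : h ∘ φ ∈ B := by
  induction hh using Algebra.adjoin_induction with
  | mem h hh =>
    obtain ⟨L, hL, rfl | rfl | ⟨m, hm, rfl⟩⟩ := hh
    · exact h1 L hL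
    · exact h2 L hL
    · exact h3 L hL m hm
  | algebraMap r => exact B.algebraMap_mem r
  | add f g _ _ hf hg => exact B.add_mem hf hg
  | mul f g _ _ hf hg => exact B.mul_mem hf hg

/-- Substituting the floor of a rational affine function for a coordinate. -/
theorem update_floor_mem_pqp [DecidableEq ι] (j : ι) {F : (ι → ℤ) → ℤ} (hF : F ∈ affineFun ι)
    {m : ℕ} (hm : 0 < m) {h : (ι → ℤ) → ℚ} (hh : h ∈ pqp ι) :
    (fun x => h (Function.update x j (F x / m))) ∈ pqp ι := by
  have hm' : (0 : ℤ) < m := by exact_mod_cast hm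
  -- `m` times the substituted affine function is affine on each residue class of `F`
  have key : ∀ L ∈ affineFun ι, ∃ N : ℕ → (ι → ℤ) → ℤ, (∀ r, N r ∈ affineFun ι) ∧
      ∀ r < m, ∀ x, (m : ℤ) ∣ F x - r → N r x = m * L (Function.update x j (F x / m)) := by
    intro L hL
    obtain ⟨c, M, hM, hi, he⟩ := exists_affineFun_split j hL
    refine ⟨fun r x => c * (F x - r) + m * M x, fun r => add_mem_affineFun
      (mul_mem_affineFun _ (sub_mem_affineFun hF (const_mem_affineFun _)))
      (mul_mem_affineFun _ hM), fun r hr x hx => ?_⟩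
    obtain ⟨q, hq⟩ := hx
    have : F x / m = q := by
      rw [show F x = r + m * q by omega, Int.add_mul_ediv_left _ _ hm'.ne',
        Int.ediv_eq_zero_of_lt (by omega) (by omega), zero_add]
    simp only [he, hi, Function.update_self, this]
    rw [hq]; ring
  refine comp_mem_pqp (fun x => Function.update x j (F x / m)) (pqp ι) ?_ ?_ ?_ hh
  · intro L hL
    obtain ⟨N, hN, hNL⟩ := key L hL
    refine mem_pqp_of_residues hF hm (fun r x => (m : ℚ)⁻¹ * N r x)
      (fun r _ => (pqp ι).smul_mem (cast_mem_pqp (hN r)) _) fun r hr x hx => ?_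
    rw [hNL r hr x hx]
    push_cast
    field_simp
  · intro L hL
    obtain ⟨N, hN, hNL⟩ := key L hL
    refine mem_pqp_of_residues hF hm _ (fun r _ => halfSpace_mem_pqp (hN r)) fun r hr x hx => ?_
    exact ind_congr (by rw [hNL r hr x hx, mul_nonneg_iff_of_pos_left hm'])
  · intro L hL p hp
    obtain ⟨N, hN, hNL⟩ := key L hL
    refine mem_pqp_of_residues hF hm _
      (fun r _ => congruence_mem_pqp (hN r) (Nat.mul_pos hm hp)) fun r hr x hx => ?_
    exact ind_congr (by rw [hNL r hr x hx, Nat.cast_mul, mul_dvd_mul_iff_left hm'.ne'])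

end PiecewiseQuasiPolynomials

section Summation

/-- Every rational polynomial is a forward difference. -/
theorem exists_polynomial_forwardDiff (p : Polynomial ℚ) :
    ∃ q : Polynomial ℚ, ∀ t : ℚ, q.eval (t + 1) - q.eval t = p.eval t := by
  induction p using Polynomial.induction_on' with
  | add p p' h h' =>
    obtain ⟨q, hq⟩ := h
    obtain ⟨q', hq'⟩ := h'
    refine ⟨q + q', fun t => ?_⟩
    rw [Polynomial.eval_add, Polynomial.eval_add, Polynomial.eval_add, ← hq, ← hq']
    ring
  | monomial k a =>
    refine ⟨Polynomial.C (a / (k + 1)) * Polynomial.bernoulli (k + 1), fun t => ?_⟩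
    have h : ((k : ℚ) + 1) ≠ 0 := by positivity
    rw [Polynomial.eval_C_mul, Polynomial.eval_C_mul, add_comm t 1,
      Polynomial.bernoulli_eval_one_add, Polynomial.eval_monomial]
    push_cast
    field_simp
    ring

/-- Quasi-polynomial functions of one integer variable. -/
def IsQuasiPoly (q : ℤ → ℚ) : Prop :=
  ∃ (m : ℕ) (P : ℤ → Polynomial ℚ), 0 < m ∧ ∀ t, q t = (P (t % m)).eval (t : ℚ)

theorem IsQuasiPoly.mul {q q' : ℤ → ℚ} (h : IsQuasiPoly q) (h' : IsQuasiPoly q') :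
    IsQuasiPoly fun t => q t * q' t := by
  obtain ⟨m, P, hm, hP⟩ := h
  obtain ⟨m', P', hm', hP'⟩ := h'
  refine ⟨m * m', fun t => P (t % m) * P' (t % m'), Nat.mul_pos hm hm', fun t => ?_⟩
  simp only [hP, hP']
  rw [Polynomial.eval_mul, Nat.cast_mul, Int.emod_emod_of_dvd _ (dvd_mul_right _ _),
    Int.emod_emod_of_dvd _ (dvd_mul_left _ _)]

theorem IsQuasiPoly.one : IsQuasiPoly fun _ => 1 :=
  ⟨1, fun _ => 1, one_pos, by simp⟩

theorem IsQuasiPoly.const_mul_id (c : ℚ) : IsQuasiPoly fun t => c * t :=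
  ⟨1, fun _ => Polynomial.C c * Polynomial.X, one_pos, by simp⟩

theorem IsQuasiPoly.residue {m : ℕ} (hm : 0 < m) (r : ℤ) :
    IsQuasiPoly (ind fun t : ℤ => (m : ℤ) ∣ t - r) := by
  refine ⟨m, fun t => Polynomial.C (ind (fun t : ℤ => (m : ℤ) ∣ t - r) t), hm, fun t => ?_⟩
  rw [Polynomial.eval_C]
  refine ind_congr ?_
  rw [← dvd_add_right (Int.dvd_self_sub_emod (x := t) (m := m)) (c := t % m - r),
    sub_add_sub_cancel]

theorem sum_residue_mul {m : ℕ} (hm : 0 < m) (t : ℤ) (g : ℤ → ℚ) :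
    ∑ r ∈ Finset.Ico (0 : ℤ) m, ind (fun t : ℤ => (m : ℤ) ∣ t - r) t * g r = g (t % m) := by
  have hm' : (0 : ℤ) < m := by exact_mod_cast hm
  rw [Finset.sum_eq_single (t % m)]
  · rw [ind_pos (P := fun t' : ℤ => (m : ℤ) ∣ t' - t % m) Int.dvd_self_sub_emod, one_mul]
  · intro r hr hne
    rw [ind_neg (P := fun t : ℤ => (m : ℤ) ∣ t - r), zero_mul]
    intro hd
    rw [Finset.mem_Ico] at hr
    exact hne ((Int.emod_eq_of_lt hr.1 hr.2).symm.trans (Int.modEq_iff_dvd.2 hd))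
  · intro h
    exact absurd (Finset.mem_Ico.2 ⟨Int.emod_nonneg _ hm'.ne', Int.emod_lt_of_pos _ hm'⟩) h

variable {ι : Type*}

theorem eval_mem_pqp (p : Polynomial ℚ) {h : (ι → ℤ) → ℚ} (hh : h ∈ pqp ι) :
    (fun x => p.eval (h x)) ∈ pqp ι := by
  have key : (fun x => p.eval (h x)) = p.sum fun k c => c • h ^ k := by
    ext x
    simp [Polynomial.eval_eq_sum, Polynomial.sum]
  rw [key]
  exact (pqp ι).sum_mem fun k _ => (pqp ι).smul_mem ((pqp ι).pow_mem hh k) _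

variable [DecidableEq ι]

/-- The functions which are forward differences in the coordinate `j` of functions in `pqp`. -/
noncomputable def forwardDiffRange (j : ι) : Submodule ℚ ((ι → ℤ) → ℚ) where
  carrier := {h | ∃ H ∈ pqp ι, ∀ x, H (Function.update x j (x j + 1)) - H x = h x}
  add_mem' := by
    rintro h h' ⟨H, hH, e⟩ ⟨H', hH', e'⟩
    exact ⟨H + H', (pqp ι).add_mem hH hH', fun x => by simp only [Pi.add_apply, ← e, ← e']; ring⟩
  zero_mem' := ⟨0, (pqp ι).zero_mem, by simp⟩
  smul_mem' := by
    rintro c h ⟨H, hH, e⟩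
    exact ⟨c • H, (pqp ι).smul_mem hH c, fun x => by
      simp only [Pi.smul_apply, ← e, smul_eq_mul]; ring⟩

theorem mul_mem_forwardDiffRange {j : ι} {g h : (ι → ℤ) → ℚ} (hg : g ∈ pqp ι)
    (hgj : ∀ x t, g (Function.update x j t) = g x) (hh : h ∈ forwardDiffRange j) :
    g * h ∈ forwardDiffRange j := by
  obtain ⟨H, hH, e⟩ := hh
  exact ⟨g * H, (pqp ι).mul_mem hg hH, fun x => by
    simp only [Pi.mul_apply, ← e, hgj]; ring⟩

theorem residue_mul_eval_mem_forwardDiffRange (j : ι) {m : ℕ} (hm : 0 < m) (r : ℤ)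
    (p : Polynomial ℚ) :
    (fun x : ι → ℤ => ind (fun t : ℤ => (m : ℤ) ∣ t - r) (x j) * p.eval (x j : ℚ)) ∈
      forwardDiffRange j := by
  have hm' : (0 : ℤ) < m := by exact_mod_cast hm
  obtain ⟨q, hq⟩ := exists_polynomial_forwardDiff
    (p.comp (Polynomial.C (m : ℚ) * Polynomial.X + Polynomial.C (r : ℚ)))
  have hF : (fun x : ι → ℤ => x j + (m - 1 - r)) ∈ affineFun ι :=
    add_mem_affineFun (coord_mem_affineFun j) (const_mem_affineFun _)
  refine ⟨_, update_floor_mem_pqp j hF hm (eval_mem_pqp q (cast_mem_pqp (coord_mem_affineFun j))),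
    fun x => ?_⟩
  simp only [Function.update_self]
  by_cases hx : (m : ℤ) ∣ x j - r
  · rw [ind_pos (P := fun t : ℤ => (m : ℤ) ∣ t - r) hx, one_mul]
    obtain ⟨s, hs⟩ := hx
    have e1 : (x j + 1 + (m - 1 - r)) / m = s + 1 := by
      rw [show x j + 1 + (m - 1 - r) = (s + 1) * m by linarith]
      exact Int.mul_ediv_cancel _ hm'.ne'
    have e2 : (x j + (m - 1 - r)) / m = s := by
      rw [show x j + (m - 1 - r) = (m - 1) + m * s by linarith, Int.add_mul_ediv_left _ _ hm'.ne',
        Int.ediv_eq_zero_of_lt (by omega) (by omega), zero_add]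
    rw [e1, e2]
    push_cast
    rw [hq]
    have : (x j : ℚ) = m * s + r := by
      rw [show x j = m * s + r by linarith]; push_cast; ring
    simp [this]
  · rw [ind_neg (P := fun t : ℤ => (m : ℤ) ∣ t - r) hx, zero_mul, sub_eq_zero]
    have h0 := Int.emod_nonneg (x j - r) hm'.ne'
    have h1 := Int.emod_lt_of_pos (x j - r) hm'
    have h2 : (x j - r) % m ≠ 0 := fun h => hx (Int.dvd_of_emod_eq_zero h)
    have h3 := Int.emod_add_mul_ediv (x j - r) m
    set u := (x j - r) % m
    set s := (x j - r) / m
    have e1 : (x j + 1 + (m - 1 - r)) / m = s + 1 := by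
      rw [show x j + 1 + (m - 1 - r) = u + m * (s + 1) by linarith,
        Int.add_mul_ediv_left _ _ hm'.ne', Int.ediv_eq_zero_of_lt (by omega) (by omega), zero_add]
    have e2 : (x j + (m - 1 - r)) / m = s + 1 := by
      rw [show x j + (m - 1 - r) = (u - 1) + m * (s + 1) by linarith,
        Int.add_mul_ediv_left _ _ hm'.ne', Int.ediv_eq_zero_of_lt (by omega) (by omega), zero_add]
    rw [e1, e2]

theorem IsQuasiPoly.mem_forwardDiffRange (j : ι) {q : ℤ → ℚ} (hq : IsQuasiPoly q) :
    (fun x : ι → ℤ => q (x j)) ∈ forwardDiffRange j := by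
  obtain ⟨m, P, hm, hP⟩ := hq
  have : (fun x : ι → ℤ => q (x j)) = ∑ r ∈ Finset.Ico (0 : ℤ) m,
      fun x : ι → ℤ => ind (fun t : ℤ => (m : ℤ) ∣ t - r) (x j) * (P r).eval (x j : ℚ) := by
    ext x
    rw [Finset.sum_apply, sum_residue_mul hm (x j) fun r => (P r).eval (x j : ℚ), hP]
  rw [this]
  exact Submodule.sum_mem _ fun r _ => residue_mul_eval_mem_forwardDiffRange j hm r (P r)

theorem halfSpace_mul_mem_forwardDiffRange {j : ι} {c : ℕ} (hc : 0 < c) {M : (ι → ℤ) → ℤ}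
    (hM : M ∈ affineFun ι) (hMj : ∀ x t, M (Function.update x j t) = M x) {h : (ι → ℤ) → ℚ}
    (hh : h ∈ forwardDiffRange j) :
    (ind fun x => 0 ≤ c * x j + M x) * h ∈ forwardDiffRange j := by
  have hc' : (0 : ℤ) < c := by exact_mod_cast hc
  obtain ⟨G, hG, e⟩ := hh
  have hF : (fun x => (c - 1) - M x) ∈ affineFun ι := sub_mem_affineFun (const_mem_affineFun _) hM
  have hL : (fun x => c * x j + M x) ∈ affineFun ι :=
    add_mem_affineFun (mul_mem_affineFun _ (coord_mem_affineFun j)) hM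
  refine ⟨_, (pqp ι).mul_mem (halfSpace_mem_pqp hL)
    ((pqp ι).sub_mem hG (update_floor_mem_pqp j hF hc hG)), fun x => ?_⟩
  simp only [Pi.mul_apply, Pi.sub_apply, Function.update_idem, hMj]
  have hx := e x
  set P : (ι → ℤ) → Prop := fun x => 0 ≤ c * x j + M x with hP
  by_cases h1 : P x
  · have h2 : P (Function.update x j (x j + 1)) := by
      simp only [hP, Function.update_self, hMj] at h1 ⊢
      nlinarith
    rw [ind_pos h1, ind_pos h2]
    linarith
  · rw [ind_neg h1]
    by_cases h2 : P (Function.update x j (x j + 1))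
    · have h3 : (c - 1 - M x) / c = x j + 1 := by
        simp only [hP, Function.update_self, hMj] at h1 h2
        rw [Int.ediv_eq_iff_of_pos hc']
        constructor <;> nlinarith
      rw [h3]; simp
    · rw [ind_neg h2]
      simp

/-- Every piecewise quasi-polynomial function is a forward difference of another one. -/
theorem mem_forwardDiffRange (j : ι) {h : (ι → ℤ) → ℚ} (hh : h ∈ pqp ι) :
    h ∈ forwardDiffRange j := by
  suffices H : ∀ h ∈ pqp ι, ∀ q, IsQuasiPoly q → (h * fun x => q (x j)) ∈ forwardDiffRange j by
    have := H h hh _ IsQuasiPoly.one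
    rwa [show (fun _ : ι → ℤ => (1 : ℚ)) = 1 from rfl, mul_one] at this
  clear h hh
  intro h hh
  rw [pqp, ← Subalgebra.mem_toSubmodule, Algebra.adjoin_eq_span] at hh
  induction hh using Submodule.span_induction with
  | zero => intro q _; rw [zero_mul]; exact Submodule.zero_mem _
  | add h h' _ _ ih ih' => intro q hq; rw [add_mul]; exact Submodule.add_mem _ (ih q hq) (ih' q hq)
  | smul c h _ ih => intro q hq; rw [smul_mul_assoc]; exact Submodule.smul_mem _ c (ih q hq)
  | mem h hh =>
    induction hh using Submonoid.closure_induction_left with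
    | one => intro q hq; rw [one_mul]; exact hq.mem_forwardDiffRange j
    | mul_left u hu h _ ih =>
      intro q hq
      rw [mul_assoc]
      obtain ⟨L, hL, hu⟩ := hu
      obtain ⟨c, M, hM, hMj, he⟩ := exists_affineFun_split j hL
      rcases hu with rfl | rfl | ⟨m, hm, rfl⟩
      · have h1 := ih _ ((IsQuasiPoly.const_mul_id c).mul hq)
        have h2 := mul_mem_forwardDiffRange (cast_mem_pqp hM) (by simp [hMj]) (ih q hq)
        convert Submodule.add_mem _ h1 h2 using 1
        ext x
        simp only [Pi.mul_apply, Pi.add_apply, he]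
        push_cast
        ring
      · obtain hc | rfl | hc := lt_trichotomy c 0
        · obtain ⟨d, rfl⟩ : ∃ d : ℕ, c = -d := ⟨c.natAbs, by omega⟩
          have h1 := halfSpace_mul_mem_forwardDiffRange (j := j) (c := d) (by omega)
            (M := fun x => (-1) - M x) (sub_mem_affineFun (const_mem_affineFun _) hM)
            (by simp [hMj]) (ih q hq)
          convert Submodule.sub_mem _ (ih q hq) h1 using 1
          ext x
          simp only [Pi.mul_apply, Pi.sub_apply]
          by_cases hx : 0 ≤ L x
          · rw [ind_pos (P := fun x => 0 ≤ L x) hx, ind_neg (by rw [he] at hx; linarith)]; ring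
          · rw [ind_neg (P := fun x => 0 ≤ L x) hx, ind_pos (by rw [he] at hx; linarith)]; ring
        · have : L = M := by ext x; simp [he]
          subst this
          exact mul_mem_forwardDiffRange (halfSpace_mem_pqp hL)
            (fun x t => ind_congr (by rw [hMj])) (ih q hq)
        · obtain ⟨d, rfl⟩ : ∃ d : ℕ, c = d := ⟨c.natAbs, by omega⟩
          simp only [he]
          exact halfSpace_mul_mem_forwardDiffRange (by omega) hM hMj (ih q hq)
      · have key : (ind fun x => (m : ℤ) ∣ L x) * (h * fun x => q (x j)) =
            ∑ r ∈ Finset.Ico (0 : ℤ) m, (ind fun x => (m : ℤ) ∣ c * r + M x) *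
              (h * fun x => (ind (fun t : ℤ => (m : ℤ) ∣ t - r) (x j)) * q (x j)) := by
          ext x
          simp only [Finset.sum_apply, Pi.mul_apply]
          have e : ∀ r : ℤ, ind (fun x => (m : ℤ) ∣ c * r + M x) x *
              (h x * (ind (fun t : ℤ => (m : ℤ) ∣ t - r) (x j) * q (x j))) =
              ind (fun t : ℤ => (m : ℤ) ∣ t - r) (x j) *
              (ind (fun x => (m : ℤ) ∣ c * r + M x) x * (h x * q (x j))) := fun r => by ring
          simp only [e]
          rw [sum_residue_mul hm (x j)
            fun r => ind (fun x => (m : ℤ) ∣ c * r + M x) x * (h x * q (x j))]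
          congr 1
          refine ind_congr ?_
          rw [he, ← dvd_add_right (dvd_mul_of_dvd_right
            (Int.dvd_self_sub_emod (x := x j) (m := m)) c) (c := c * (x j % m) + M x)]
          ring_nf
        rw [key]
        refine Submodule.sum_mem _ fun r _ => mul_mem_forwardDiffRange
          (congruence_mem_pqp (add_mem_affineFun (const_mem_affineFun _) hM) hm)
          (fun x t => ind_congr (by rw [hMj])) (ih _ ((IsQuasiPoly.residue hm r).mul hq))

end Summation

section BoxSums

variable {ι : Type*} [DecidableEq ι]

/-- Substituting an affine function for a coordinate. -/
theorem update_mem_pqp (j : ι) {F : (ι → ℤ) → ℤ} (hF : F ∈ affineFun ι) {h : (ι → ℤ) → ℚ}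
    (hh : h ∈ pqp ι) : (fun x => h (Function.update x j (F x))) ∈ pqp ι := by
  simpa using update_floor_mem_pqp j hF one_pos hh

theorem exists_pqp_sum_range {j o : ι} {h : (ι → ℤ) → ℚ} (hh : h ∈ pqp ι) :
    ∃ H ∈ pqp ι, ∀ (x : ι → ℤ) (n : ℕ), x o = n →
      H x = ∑ t ∈ Finset.range n, h (Function.update x j (t : ℤ)) := by
  obtain ⟨G, hG, e⟩ := mem_forwardDiffRange j hh
  refine ⟨_, (pqp ι).sub_mem (update_mem_pqp j (coord_mem_affineFun o) hG)
    (update_mem_pqp j (const_mem_affineFun 0) hG), fun x n hn => ?_⟩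
  simp only [Pi.sub_apply, hn]
  have := Finset.sum_range_sub (fun t : ℕ => G (Function.update x j (t : ℤ))) n
  rw [Nat.cast_zero] at this
  rw [← this]
  refine Finset.sum_congr rfl fun t _ => ?_
  rw [← e]
  simp

/-- Summation of a piecewise quasi-polynomial function over a box in some of the coordinates. -/
theorem exists_pqp_sum_box [Fintype ι] (o : ι) {h : (ι → ℤ) → ℚ} (hh : h ∈ pqp ι)
    (s : Finset ι) (hs : o ∉ s) :
    ∃ H ∈ pqp ι, ∀ (x : ι → ℤ) (n : ℕ), x o = n → H x =
      ∑ y ∈ Fintype.piFinset fun i => if i ∈ s then Finset.Ico (0 : ℤ) n else {x i}, h y := by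
  induction s using Finset.induction_on with
  | empty =>
    refine ⟨h, hh, fun x n _ => ?_⟩
    simp [Fintype.piFinset_singleton]
  | insert j s hj ih =>
    rw [Finset.mem_insert, not_or] at hs
    obtain ⟨G, hG, e⟩ := ih hs.2
    obtain ⟨H, hH, e'⟩ := exists_pqp_sum_range (j := j) (o := o) hG
    refine ⟨H, hH, fun x n hn => ?_⟩
    rw [e' x n hn, ← Finset.sum_fiberwise_of_maps_to (s := Fintype.piFinset _)
      (t := Finset.Ico (0 : ℤ) n) (g := fun y => y j) (fun y hy => by
        have := Fintype.mem_piFinset.1 hy j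
        simpa using this)]
    refine Finset.sum_bij (fun t _ => (t : ℤ)) (by simp) (by simp) (fun b hb => ?_) fun t ht => ?_
    · rw [Finset.mem_Ico] at hb
      exact ⟨b.toNat, by simp; omega, by simp [hb.1]⟩
    · rw [e _ n (by rw [Function.update_of_ne hs.1, hn])]
      refine Finset.sum_congr ?_ fun _ _ => rfl
      ext y
      simp only [Fintype.mem_piFinset, Finset.mem_filter, Finset.mem_insert]
      have ht' : t < n := by simpa using ht
      constructor
      · intro H
        have hyj : y j = t := by simpa [hj] using H j
        refine ⟨fun i => ?_, hyj⟩
        by_cases hi : i = j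
        · subst hi; simp [hyj, ht']
        · simpa [hi] using H i
      · rintro ⟨H, hyj⟩ i
        by_cases hi : i = j
        · subst hi; simp [hyj, hj]
        · simpa [hi] using H i

/-- Functions on `ℕ` which are eventually given by polynomials on residue classes. -/
def IsEventuallyQuasiPoly (g : ℕ → ℚ) : Prop :=
  ∃ (N p : ℕ) (P : ℕ → Polynomial ℚ), 0 < p ∧ ∀ n, N ≤ n → g n = (P (n % p)).eval (n : ℚ)

theorem IsEventuallyQuasiPoly.op {g g' : ℕ → ℚ} (F : ℚ → ℚ → ℚ)
    (F' : Polynomial ℚ → Polynomial ℚ → Polynomial ℚ)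
    (hF : ∀ P P' t, (F' P P').eval t = F (P.eval t) (P'.eval t))
    (h : IsEventuallyQuasiPoly g) (h' : IsEventuallyQuasiPoly g') :
    IsEventuallyQuasiPoly fun n => F (g n) (g' n) := by
  obtain ⟨N, p, P, hp, e⟩ := h
  obtain ⟨N', p', P', hp', e'⟩ := h'
  refine ⟨max N N', p * p', fun r => F' (P (r % p)) (P' (r % p')), Nat.mul_pos hp hp',
    fun n hn => ?_⟩
  simp only [hF]
  rw [Nat.mod_mul_right_mod, Nat.mod_mul_left_mod, ← e n (le_of_max_le_left hn),
    ← e' n (le_of_max_le_right hn)]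

theorem IsEventuallyQuasiPoly.of_eventually_eq {g g' : ℕ → ℚ} (h : IsEventuallyQuasiPoly g) (M : ℕ)
    (hM : ∀ n, M ≤ n → g' n = g n) : IsEventuallyQuasiPoly g' := by
  obtain ⟨N, p, P, hp, e⟩ := h
  exact ⟨max N M, p, P, hp, fun n hn => by
    rw [hM n (le_of_max_le_right hn), e n (le_of_max_le_left hn)]⟩

theorem isEventuallyQuasiPoly_polynomial (P : Polynomial ℚ) :
    IsEventuallyQuasiPoly fun n => P.eval (n : ℚ) :=
  ⟨0, 1, fun _ => P, one_pos, fun _ _ => rfl⟩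

/-- On a coordinate axis, piecewise quasi-polynomial functions are eventually quasi-polynomial. -/
theorem isEventuallyQuasiPoly_of_mem_pqp (o : ι) {h : (ι → ℤ) → ℚ} (hh : h ∈ pqp ι) :
    IsEventuallyQuasiPoly fun n => h (Function.update 0 o (n : ℤ)) := by
  have hL : ∀ L ∈ affineFun ι, ∃ c d : ℤ, ∀ n : ℕ, L (Function.update 0 o (n : ℤ)) = c * n + d := by
    intro L hL
    obtain ⟨c, M, -, hMj, he⟩ := exists_affineFun_split o hL
    exact ⟨c, M 0, fun n => by rw [he, hMj]; simp⟩
  induction hh using Algebra.adjoin_induction with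
  | algebraMap r => simpa using! isEventuallyQuasiPoly_polynomial (Polynomial.C r)
  | add f g _ _ hf hg => exact hf.op (· + ·) (· + ·) (by simp) hg
  | mul f g _ _ hf hg => exact hf.op (· * ·) (· * ·) (by simp) hg
  | mem h hh =>
    obtain ⟨L, hLa, hh⟩ := hh
    obtain ⟨c, d, hcd⟩ := hL L hLa
    rcases hh with rfl | rfl | ⟨m, hm, rfl⟩
    · convert isEventuallyQuasiPoly_polynomial
        (Polynomial.C (c : ℚ) * Polynomial.X + Polynomial.C (d : ℚ)) using 2 with n
      simp [hcd]
    · by_cases hc : 0 < c ∨ c = 0 ∧ 0 ≤ d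
      · refine (isEventuallyQuasiPoly_polynomial 1).of_eventually_eq d.natAbs fun n hn => ?_
        rw [ind_pos (P := fun x => 0 ≤ L x), Polynomial.eval_one]
        rw [hcd]
        rcases hc with hc | ⟨rfl, hd⟩
        · have : (d.natAbs : ℤ) ≤ n := by exact_mod_cast hn
          have h1 : -(n : ℤ) ≤ d := by omega
          nlinarith
        · linarith
      · refine (isEventuallyQuasiPoly_polynomial 0).of_eventually_eq (d.natAbs + 1) fun n hn => ?_
        rw [ind_neg (P := fun x => 0 ≤ L x), Polynomial.eval_zero]
        rw [hcd]
        have : (d.natAbs : ℤ) + 1 ≤ n := by exact_mod_cast hn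
        have h1 : d < n := by omega
        by_cases hc0 : c = 0
        · subst hc0
          have : ¬ 0 ≤ d := fun h => hc (.inr ⟨rfl, h⟩)
          linarith
        · have : c ≤ -1 := by
            by_contra h
            exact hc (.inl (by omega))
          nlinarith
    · refine ⟨0, m, fun r => Polynomial.C (ind (fun r : ℕ => (m : ℤ) ∣ c * r + d) r), hm,
        fun n _ => ?_⟩
      rw [Polynomial.eval_C]
      refine ind_congr ?_
      rw [hcd]
      push_cast
      rw [← dvd_add_right (dvd_mul_of_dvd_right
        (Int.dvd_self_sub_emod (x := (n : ℤ)) (m := m)) c) (c := c * (n % m) + d)]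
      ring_nf

end BoxSums

section SemilinearSets

variable {ι : Type*}

theorem sum_mem_affineFun {κ : Type*} (s : Finset κ) {L : κ → (ι → ℤ) → ℤ}
    (hL : ∀ a ∈ s, L a ∈ affineFun ι) : (fun x => ∑ a ∈ s, L a x) ∈ affineFun ι := by
  have := (affineFun ι).sum_mem hL
  rwa [Finset.sum_fn] at this

/-- Vectors of natural numbers that are independent over `ℕ` are independent over `ℚ`. -/
theorem linearIndepOn_natCast_rat {t : Set (ι → ℕ)} (ht : LinearIndepOn ℕ id t) :
    LinearIndepOn ℚ ((Nat.castAddMonoidHom ℚ).compLeft ι) t := by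
  set c := (Nat.castAddMonoidHom ℚ).compLeft ι with hc
  have inj (x y : ι → ℕ) : c x = c y ↔ x = y :=
    ⟨fun h => funext fun i => by simpa [hc] using congr_fun h i, congr_arg c⟩
  rw [LinearIndepOn, ← LinearIndependent.iff_fractionRing ℤ ℚ, ← LinearIndepOn, linearIndepOn_iff'']
  intro s f hs hf heq i hi
  rw [linearIndepOn_iff_linearIndepOn_finset] at ht
  specialize ht s hs
  rw [linearIndepOn_finset_iffₛ] at ht
  specialize ht (Int.toNat ∘ f) (Int.toNat ∘ (-·) ∘ f) ?_ i hi
  · simp_rw [← inj, map_sum]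
    rw [← sub_eq_zero, ← Finset.sum_sub_distrib, ← heq]
    refine Finset.sum_congr rfl fun j hj => ?_
    conv_rhs => rw [← (f j).toNat_sub_toNat_neg]
    simp only [sub_smul, map_nsmul, natCast_zsmul, Function.comp_apply, id_eq]
  · rw [← (f i).toNat_sub_toNat_neg, sub_eq_zero, Int.natCast_inj]
    simpa using ht

/-- Independent vectors of natural numbers have an integral left inverse up to a positive scalar. -/
theorem exists_integral_leftInverse [Fintype ι] {t : Finset (ι → ℕ)}
    (ht : LinearIndepOn ℕ id (t : Set (ι → ℕ))) :
    ∃ (D : ℕ) (A : t → ι → ℤ), 0 < D ∧ ∀ (c : t → ℤ) (p : t),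
      ∑ i, A p i * ∑ q, c q * (q.1 i : ℤ) = D * c p := by
  classical
  have h := linearIndepOn_natCast_rat ht
  obtain ⟨g, hg⟩ := LinearMap.exists_leftInverse_of_injective
    (Fintype.linearCombination ℚ fun p : t => (Nat.castAddMonoidHom ℚ).compLeft ι p.1)
    (LinearMap.ker_eq_bot.2 (linearIndependent_iff_injective_fintypeLinearCombination.1 h))
  obtain ⟨b, hb⟩ := IsLocalization.exist_integer_multiples_of_finite (nonZeroDivisors ℤ)
    fun pi : t × ι => g (Pi.single pi.2 1) pi.1
  choose A hA using hb
  have hb0 : (b : ℤ) ≠ 0 := nonZeroDivisors.ne_zero b.2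
  refine ⟨(b : ℤ).natAbs, fun p i => (b : ℤ).sign * A (p, i), Int.natAbs_pos.2 hb0, fun c p => ?_⟩
  have key : ∑ i, A (p, i) * ∑ q, c q * (q.1 i : ℤ) = b * c p := by
    have hgc := congr_fun (LinearMap.congr_fun hg fun q => (c q : ℚ)) p
    rw [LinearMap.comp_apply, LinearMap.pi_apply_eq_sum_univ g] at hgc
    simp only [Fintype.linearCombination_apply, Finset.sum_apply, Pi.smul_apply, smul_eq_mul,
      LinearMap.id_apply] at hgc
    have hA' (i : ι) : ((A (p, i) : ℤ) : ℚ) = b * g (Pi.single i 1) p := by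
      have := hA (p, i)
      simpa [Algebra.smul_def] using this
    have : ((∑ i, A (p, i) * ∑ q, c q * (q.1 i : ℤ) : ℤ) : ℚ) = ((b * c p : ℤ) : ℚ) := by
      push_cast
      rw [← hgc, Finset.mul_sum]
      refine Finset.sum_congr rfl fun i _ => ?_
      rw [hA']
      have e : (fun j => if i = j then (1 : ℚ) else 0) = Pi.single i 1 := by
        ext j; simp [Pi.single_apply, eq_comm]
      simp only [e, AddMonoidHom.compLeft_apply, Function.comp_apply, Nat.coe_castAddMonoidHom]
      ring
    exact_mod_cast this
  simp only [mul_assoc, ← Finset.mul_sum]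
  rw [key, ← mul_assoc, Int.sign_mul_self_eq_natAbs]

theorem IsProperLinearSet.exists_ind_mem_pqp [Finite ι] {s : Set (ι → ℕ)}
    (hs : IsProperLinearSet s) : ∃ P : (ι → ℤ) → Prop, ind P ∈ pqp ι ∧
      ∀ x : ι → ℕ, P (fun i => x i) ↔ x ∈ s := by
  have := Fintype.ofFinite ι
  obtain ⟨a, t, ht, rfl⟩ := isProperLinearSet_iff.1 hs
  obtain ⟨D, A, hD, hA⟩ := exists_integral_leftInverse ht
  let y (p : t) (x : ι → ℤ) : ℤ := ∑ i, A p i * (x i - a i)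
  have hy (p : t) : y p ∈ affineFun ι := sum_mem_affineFun _ fun i _ =>
    mul_mem_affineFun _ (sub_mem_affineFun (coord_mem_affineFun i) (const_mem_affineFun _))
  let E (i : ι) (x : ι → ℤ) : ℤ := D * (x i - a i) - ∑ p, (p.1 i : ℤ) * y p x
  have hE (i : ι) : E i ∈ affineFun ι := sub_mem_affineFun
    (mul_mem_affineFun _ (sub_mem_affineFun (coord_mem_affineFun i) (const_mem_affineFun _)))
    (sum_mem_affineFun _ fun p _ => mul_mem_affineFun _ (hy p))
  refine ⟨fun x => (∀ p, (D : ℤ) ∣ y p x ∧ 0 ≤ y p x) ∧ ∀ i, 0 ≤ E i x ∧ 0 ≤ -1 * E i x,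
    and_mem_pqp (forall_mem_pqp fun p => and_mem_pqp (congruence_mem_pqp (hy p) hD)
      (halfSpace_mem_pqp (hy p))) (forall_mem_pqp fun i => and_mem_pqp (halfSpace_mem_pqp (hE i))
      (halfSpace_mem_pqp (mul_mem_affineFun (-1) (hE i)))), fun x => ?_⟩
  have hD' : (D : ℤ) ≠ 0 := by exact_mod_cast hD.ne'
  constructor
  · rintro ⟨h, h'⟩
    choose c hc using fun p => (h p).1
    have hc0 (p) : 0 ≤ c p := by
      have := (h p).2
      rw [hc] at this
      exact nonneg_of_mul_nonneg_right this (by exact_mod_cast hD)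
    refine Set.mem_vadd_set.2 ⟨∑ p, (c p).toNat • p.1,
      AddSubmonoid.mem_closure_finset'.2 ⟨_, rfl⟩, funext fun i => ?_⟩
    obtain ⟨h1, h2⟩ := h' i
    have h3 : (D : ℤ) * (x i - a i) - ∑ p, (p.1 i : ℤ) * y p (fun i => x i) = 0 :=
      le_antisymm (by simp only [E] at h2; linarith) h1
    have h4 : ((x i : ℤ) - a i) = ∑ p, c p * (p.1 i : ℤ) := by
      apply mul_left_cancel₀ hD'
      rw [sub_eq_zero.1 h3, Finset.mul_sum]
      exact Finset.sum_congr rfl fun p _ => by rw [hc]; ring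
    have h5 : ((a i + ∑ p, (c p).toNat * p.1 i : ℕ) : ℤ) = x i := by
      push_cast
      simp only [Int.toNat_of_nonneg (hc0 _)]
      linarith
    simpa [vadd_eq_add] using Int.natCast_inj.1 h5
  · intro hx
    obtain ⟨z, hz, rfl⟩ := Set.mem_vadd_set.1 hx
    obtain ⟨c, rfl⟩ := AddSubmonoid.mem_closure_finset'.1 hz
    have hd (i : ι) : (((a +ᵥ ∑ p, c p • p.1 : ι → ℕ) i : ℕ) : ℤ) - a i
        = ∑ p, (c p : ℤ) * (p.1 i : ℤ) := by simp [vadd_eq_add]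
    have hyc (p) : y p (fun i => ((a +ᵥ ∑ p, c p • p.1 : ι → ℕ) i : ℕ)) = D * c p := by
      simp only [y, hd]
      exact hA (fun p => c p) p
    have hE0 (i) : E i (fun i => ((a +ᵥ ∑ p, c p • p.1 : ι → ℕ) i : ℕ)) = 0 := by
      simp only [E, hd, hyc, Finset.mul_sum, ← Finset.sum_sub_distrib]
      exact Finset.sum_eq_zero fun p _ => by ring
    refine ⟨fun p => ?_, fun i => by rw [hE0]; simp⟩
    rw [hyc]
    exact ⟨dvd_mul_right _ _, by positivity⟩

/-- Semilinear sets have piecewise quasi-polynomial indicator functions. -/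
theorem IsSemilinearSet.exists_ind_mem_pqp [Finite ι] {s : Set (ι → ℕ)} (hs : IsSemilinearSet s) :
    ∃ P : (ι → ℤ) → Prop, ind P ∈ pqp ι ∧ ∀ x : ι → ℕ, P (fun i => x i) ↔ x ∈ s := by
  obtain ⟨S, hS, hS', rfl⟩ := hs.isProperSemilinearSet
  have := hS.to_subtype
  choose P hP hPs using fun u : S => (hS' u u.2).exists_ind_mem_pqp
  exact ⟨fun x => ∃ u, P u x, exists_mem_pqp hP, fun x => by simp [hPs]⟩

end SemilinearSets

section AffineSemilinear

variable {ι : Type*}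

theorem exists_addMonoidHom_of_mem_affineFun {L : (ι → ℤ) → ℤ} (hL : L ∈ affineFun ι) :
    ∃ (b : ℤ) (f : (ι → ℕ) →+ ℤ), ∀ x : ι → ℕ, L (fun i => x i) = b + f x := by
  induction hL using Submodule.span_induction with
  | mem L h =>
    rcases h with rfl | ⟨i, rfl⟩
    · exact ⟨1, 0, by simp⟩
    · exact ⟨0, (Nat.castAddMonoidHom ℤ).comp (Pi.evalAddMonoidHom _ i), by simp⟩
  | zero => exact ⟨0, 0, by simp⟩
  | add L L' _ _ h h' =>
    obtain ⟨b, f, h⟩ := h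
    obtain ⟨b', f', h'⟩ := h'
    exact ⟨b + b', f + f', fun x => by
      simp only [Pi.add_apply, h, h', AddMonoidHom.add_apply]; ring⟩
  | smul a L _ h =>
    obtain ⟨b, f, h⟩ := h
    exact ⟨a * b, a • f, fun x => by
      simp only [Pi.smul_apply, h, AddMonoidHom.smul_apply, smul_eq_mul]; ring⟩

variable [Finite ι]

theorem isSemilinearSet_affine_eq_zero {L : (ι → ℤ) → ℤ} (hL : L ∈ affineFun ι) :
    IsSemilinearSet {x : ι → ℕ | L (fun i => x i) = 0} := by
  obtain ⟨b, f, h⟩ := exists_addMonoidHom_of_mem_affineFun hL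
  simpa [h] using isSemilinearSet_setOfPred_eq b 0 f (0 : (ι → ℕ) →+ ℤ)

theorem isSemilinearSet_affine_nonneg {L : (ι → ℤ) → ℤ} (hL : L ∈ affineFun ι) :
    IsSemilinearSet {x : ι → ℕ | 0 ≤ L (fun i => x i)} := by
  obtain ⟨b, f, h⟩ := exists_addMonoidHom_of_mem_affineFun hL
  have hs := (IsSemilinearSet.closure_of_finite (Set.finite_singleton (1 : ℤ))).vadd (-b)
  convert hs.preimage f using 1
  ext x
  simp only [h, Set.mem_ofPred_eq, Set.mem_preimage, Set.mem_vadd_set, SetLike.mem_coe,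
    AddSubmonoid.mem_closure_singleton, vadd_eq_add]
  constructor
  · exact fun hx => ⟨b + f x, ⟨(b + f x).toNat, by simpa using hx⟩, by ring⟩
  · rintro ⟨_, ⟨m, rfl⟩, hm⟩
    have : (0 : ℤ) ≤ m • 1 := by simp
    linarith

end AffineSemilinear

section Digits

variable {V W : Type*} {R : ℕ}

theorem sum_digits_lt {n : ℕ} {d : Fin R → ℕ} (hd : ∀ r, d r < n) :
    ∑ r, d r * n ^ (r : ℕ) < n ^ R := by
  have := (finFunctionFinEquiv fun r => (⟨d r, hd r⟩ : Fin n)).2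
  rwa [finFunctionFinEquiv_apply] at this

theorem exists_digits {n z : ℕ} (hz : z < n ^ R) :
    ∃ d : Fin R → ℕ, (∀ r, d r < n) ∧ ∑ r, d r * n ^ (r : ℕ) = z := by
  refine ⟨fun r => finFunctionFinEquiv.symm ⟨z, hz⟩ r, fun r => Fin.is_lt _, ?_⟩
  rw [← finFunctionFinEquiv_apply, Equiv.apply_symm_apply]

theorem digits_injective {n : ℕ} {d d' : Fin R → ℕ} (hd : ∀ r, d r < n) (hd' : ∀ r, d' r < n)
    (h : ∑ r, d r * n ^ (r : ℕ) = ∑ r, d' r * n ^ (r : ℕ)) : d = d' := by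
  have : (fun r => (⟨d r, hd r⟩ : Fin n)) = fun r => ⟨d' r, hd' r⟩ :=
    finFunctionFinEquiv.injective (Fin.ext (by simpa only [finFunctionFinEquiv_apply] using h))
  exact funext fun r => congr_arg Fin.val (congr_fun this r)

/-- The tuples consisting of a base `x none` and digits `x (some (v, r))` below the base. -/
def digitBox (V : Type*) (R : ℕ) : Set (Option (V × Fin R) → ℕ) :=
  {x | 1 ≤ x none ∧ ∀ p, x (some p) < x none}

/-- The number with digits `x (some (v, r))` in base `x none`. -/
def ofDigits (x : Option (V × Fin R) → ℕ) (v : V) : ℕ := ∑ r, x (some (v, r)) * x none ^ (r : ℕ)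

theorem isSemilinearSet_digitBox [Finite V] : IsSemilinearSet (digitBox V R) := by
  have h : digitBox V R = {x | 0 ≤ (x none : ℤ) - 1} ∩
      ⋂ p, {x | 0 ≤ (x none : ℤ) - x (some p) - 1} := by
    ext x
    simp only [digitBox, Set.mem_ofPred_eq, Set.mem_inter_iff, Set.mem_iInter]
    refine and_congr (by omega) (forall_congr' fun p => by omega)
  rw [h]
  have hn := coord_mem_affineFun (none : Option (V × Fin R))
  exact (isSemilinearSet_affine_nonneg (sub_mem_affineFun hn (const_mem_affineFun 1))).inter
    (.iInter fun p => isSemilinearSet_affine_nonneg (sub_mem_affineFun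
      (sub_mem_affineFun hn (coord_mem_affineFun _)) (const_mem_affineFun 1)))

theorem exists_abs_le_mul_of_mem_digitBox {L : (Option (V × Fin R) → ℤ) → ℤ}
    (hL : L ∈ affineFun (Option (V × Fin R))) :
    ∃ K : ℕ, ∀ x ∈ digitBox V R, |L fun i => x i| ≤ K * x none := by
  induction hL using Submodule.span_induction with
  | mem L h =>
    rcases h with rfl | ⟨i, rfl⟩
    · exact ⟨1, fun x hx => by simpa using hx.1⟩
    · refine ⟨1, fun x hx => ?_⟩
      rcases i with _ | p
      · simp
      · simpa using (hx.2 p).le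
  | zero => exact ⟨0, by simp⟩
  | add L L' _ _ h h' =>
    obtain ⟨K, h⟩ := h
    obtain ⟨K', h'⟩ := h'
    refine ⟨K + K', fun x hx => (abs_add_le _ _).trans ?_⟩
    push_cast
    linarith [h x hx, h' x hx]
  | smul a L _ h =>
    obtain ⟨K, h⟩ := h
    refine ⟨a.natAbs * K, fun x hx => ?_⟩
    simp only [Pi.smul_apply, smul_eq_mul, abs_mul, Nat.cast_mul, Int.natCast_natAbs, mul_assoc]
    exact mul_le_mul_of_nonneg_left (h x hx) (abs_nonneg a)

/-- The vanishing of a polynomial in the base with affine coefficients is a semilinear condition: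
the carries are bounded. -/
theorem isSemilinearSet_sum_mul_pow_eq_zero [Finite V] (N : ℕ) (e : ℤ)
    (C : ℕ → (Option (V × Fin R) → ℤ) → ℤ) (hC : ∀ l, C l ∈ affineFun (Option (V × Fin R))) :
    IsSemilinearSet {x ∈ digitBox V R |
      e + ∑ l ∈ Finset.range N, C l (fun i => x i) * (x none : ℤ) ^ l = 0} := by
  induction N generalizing e C with
  | zero =>
    by_cases h : e = 0
    · simpa [h] using isSemilinearSet_digitBox
    · simp [h]
  | succ N ih =>
    obtain ⟨K, hK⟩ := exists_abs_le_mul_of_mem_digitBox (hC 0)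
    have key : {x ∈ digitBox V R |
        e + ∑ l ∈ Finset.range (N + 1), C l (fun i => x i) * (x none : ℤ) ^ l = 0} =
        ⋃ e' ∈ Finset.Icc (-(K + |e|)) (K + |e|),
          {x | e + C 0 (fun i => x i) - e' * x none = 0} ∩ {x ∈ digitBox V R |
            e' + ∑ l ∈ Finset.range N, C (l + 1) (fun i => x i) * (x none : ℤ) ^ l = 0} := by
      ext x
      have hsum : ∑ l ∈ Finset.range (N + 1), C l (fun i => x i) * (x none : ℤ) ^ l =
          C 0 (fun i => x i) +
            x none * ∑ l ∈ Finset.range N, C (l + 1) (fun i => x i) * (x none : ℤ) ^ l := by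
        rw [Finset.sum_range_succ', Finset.mul_sum]
        simp only [pow_zero, mul_one, pow_succ]
        rw [add_comm]
        congr 1
        exact Finset.sum_congr rfl fun l _ => by ring
      simp only [Set.mem_ofPred_eq, Set.mem_iUnion, Set.mem_inter_iff, Finset.mem_Icc, exists_prop,
        hsum]
      set T := ∑ l ∈ Finset.range N, C (l + 1) (fun i => x i) * (x none : ℤ) ^ l
      constructor
      · rintro ⟨hx, h⟩
        have hn : (1 : ℤ) ≤ x none := by exact_mod_cast hx.1
        refine ⟨-T, abs_le.1 ?_, by linarith, hx, by ring⟩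
        have h1 := hK x hx
        have h2 : |T| * x none ≤ (K + |e|) * x none := by
          calc |T| * x none = |T * x none| := by rw [abs_mul, Nat.abs_cast]
            _ = |e + C 0 fun i => x i| := by
              rw [← abs_neg]; congr 1; linarith
            _ ≤ |e| + K * x none := (abs_add_le _ _).trans (by linarith)
            _ ≤ _ := by nlinarith [abs_nonneg e]
        rw [abs_neg]
        exact le_of_mul_le_mul_right h2 (by linarith)
      · rintro ⟨e', -, h1, hx, h2⟩
        refine ⟨hx, ?_⟩
        have : T = -e' := by linarith
        rw [this]
        linarith
    rw [key]
    refine .biUnion_finset fun e' _ => (isSemilinearSet_affine_eq_zero (sub_mem_affineFun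
      (add_mem_affineFun (const_mem_affineFun e) (hC 0))
      (mul_mem_affineFun e' (coord_mem_affineFun none)))).inter (ih e' _ fun l => hC (l + 1))

/-- Polynomials in the base with coefficients that are affine in the digits. -/
def digitExpr (V : Type*) (R : ℕ) : Submodule ℤ ((Option (V × Fin R) → ℕ) → ℤ) :=
  Submodule.span ℤ {E | ∃ L ∈ affineFun (Option (V × Fin R)), ∃ l : ℕ,
    E = fun x => L (fun i => x i) * (x none : ℤ) ^ l}

theorem exists_sum_of_mem_digitExpr {E : (Option (V × Fin R) → ℕ) → ℤ} (hE : E ∈ digitExpr V R) :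
    ∃ C : ℕ → (Option (V × Fin R) → ℤ) → ℤ, (∀ l, C l ∈ affineFun (Option (V × Fin R))) ∧
      ∃ N, ∀ M ≥ N, ∀ x, E x = ∑ l ∈ Finset.range M, C l (fun i => x i) * (x none : ℤ) ^ l := by
  classical
  induction hE using Submodule.span_induction with
  | mem E h =>
    obtain ⟨L, hL, l, rfl⟩ := h
    refine ⟨fun m => if m = l then L else 0, fun m => ?_, l + 1, fun M hM x => ?_⟩
    · beta_reduce
      split_ifs
      exacts [hL, Submodule.zero_mem _]
    · rw [Finset.sum_eq_single_of_mem l (Finset.mem_range.2 (by omega)) fun m _ hm => by simp [hm]]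
      simp
  | zero => exact ⟨fun _ => 0, fun _ => Submodule.zero_mem _, 0, by simp⟩
  | add E E' _ _ h h' =>
    obtain ⟨C, hC, N, h⟩ := h
    obtain ⟨C', hC', N', h'⟩ := h'
    refine ⟨fun l => C l + C' l, fun l => Submodule.add_mem _ (hC l) (hC' l), max N N',
      fun M hM x => ?_⟩
    rw [Pi.add_apply, h M (le_of_max_le_left hM), h' M (le_of_max_le_right hM),
      ← Finset.sum_add_distrib]
    exact Finset.sum_congr rfl fun l _ => by simp only [Pi.add_apply]; ring
  | smul a E _ h =>
    obtain ⟨C, hC, N, h⟩ := h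
    refine ⟨fun l => a • C l, fun l => Submodule.smul_mem _ _ (hC l), N, fun M hM x => ?_⟩
    rw [Pi.smul_apply, h M hM, smul_eq_mul, Finset.mul_sum]
    exact Finset.sum_congr rfl fun l _ => by simp only [Pi.smul_apply, smul_eq_mul]; ring

theorem pow_mul_mem_digitExpr (l : ℕ) {E : (Option (V × Fin R) → ℕ) → ℤ}
    (hE : E ∈ digitExpr V R) : (fun x => (x none : ℤ) ^ l * E x) ∈ digitExpr V R := by
  induction hE using Submodule.span_induction with
  | mem E h =>
    obtain ⟨L, hL, m, rfl⟩ := h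
    exact Submodule.subset_span ⟨L, hL, m + l, by ext x; ring⟩
  | zero =>
    simp only [Pi.zero_apply, mul_zero]
    exact Submodule.zero_mem _
  | add E E' _ _ h h' =>
    simp only [Pi.add_apply, mul_add]
    exact Submodule.add_mem _ h h'
  | smul a E _ h =>
    convert Submodule.smul_mem _ a h using 1
    ext x
    simp only [Pi.smul_apply, smul_eq_mul]
    ring

theorem eval_mul_mem_digitExpr (p : Polynomial ℤ) {E : (Option (V × Fin R) → ℕ) → ℤ}
    (hE : E ∈ digitExpr V R) : (fun x => p.eval (x none : ℤ) * E x) ∈ digitExpr V R := by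
  induction p using Polynomial.induction_on' with
  | add p q hp hq =>
    simp only [Polynomial.eval_add, add_mul]
    exact Submodule.add_mem _ hp hq
  | monomial l a =>
    convert Submodule.smul_mem _ a (pow_mul_mem_digitExpr l hE) using 1
    ext x
    simp only [Polynomial.eval_monomial, Pi.smul_apply, smul_eq_mul]
    ring

theorem const_mem_digitExpr (c : ℤ) : (fun _ => c) ∈ digitExpr V R :=
  Submodule.subset_span ⟨_, const_mem_affineFun c, 0, by simp⟩

theorem ofDigits_mem_digitExpr (v : V) :
    (fun x => (ofDigits x v : ℤ)) ∈ digitExpr V R := by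
  have : (fun x : Option (V × Fin R) → ℕ => (ofDigits x v : ℤ)) =
      ∑ r : Fin R, fun x => (x (some (v, r)) : ℤ) * (x none : ℤ) ^ (r : ℕ) := by
    ext x
    simp [ofDigits]
  rw [this]
  exact Submodule.sum_mem _ fun r _ =>
    Submodule.subset_span ⟨_, coord_mem_affineFun (some (v, r)), r, rfl⟩

/-- Predicates on `n` and on numbers below `n ^ R` that are semilinear in terms of the digits in
base `n`. -/
def DigitDefinable (R : ℕ) (φ : ℕ → (V → ℕ) → Prop) : Prop :=
  IsSemilinearSet {x : Option (V × Fin R) → ℕ | x ∈ digitBox V R ∧ φ (x none) (ofDigits x)}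

theorem digitDefinable_linear_eq_zero [Fintype V] (p : V → Polynomial ℤ) (q : Polynomial ℤ) :
    DigitDefinable R fun n (y : V → ℕ) =>
      ∑ v, (p v).eval (n : ℤ) * (y v : ℤ) + q.eval (n : ℤ) = 0 := by
  have hE : (fun x => ∑ v, (p v).eval (x none : ℤ) * (ofDigits x v : ℤ) + q.eval (x none : ℤ) * 1) ∈
      digitExpr V R := by
    refine Submodule.add_mem _ ?_ (eval_mul_mem_digitExpr q (const_mem_digitExpr 1))
    have := Submodule.sum_mem (digitExpr V R) (t := Finset.univ) fun v _ =>
      eval_mul_mem_digitExpr (p v) (ofDigits_mem_digitExpr v)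
    rwa [Finset.sum_fn] at this
  obtain ⟨C, hC, N, h⟩ := exists_sum_of_mem_digitExpr hE
  have := isSemilinearSet_sum_mul_pow_eq_zero N 0 C hC
  simpa only [DigitDefinable, zero_add, ← h N le_rfl, mul_one] using this

theorem DigitDefinable.and [Finite V] {φ ψ : ℕ → (V → ℕ) → Prop} (hφ : DigitDefinable R φ)
    (hψ : DigitDefinable R ψ) : DigitDefinable R fun n y => φ n y ∧ ψ n y := by
  unfold DigitDefinable at *
  convert IsSemilinearSet.inter hφ hψ using 1
  ext x
  simp only [Set.mem_ofPred_eq, Set.mem_inter_iff]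
  tauto

theorem DigitDefinable.not [Finite V] {φ : ℕ → (V → ℕ) → Prop} (hφ : DigitDefinable R φ) :
    DigitDefinable R fun n y => ¬ φ n y := by
  unfold DigitDefinable at *
  convert isSemilinearSet_digitBox.inter (IsSemilinearSet.compl hφ) using 1
  ext x
  simp only [Set.mem_ofPred_eq, Set.mem_inter_iff, Set.mem_compl_iff]
  tauto

theorem DigitDefinable.exists {φ : ℕ → (V ⊕ W → ℕ) → Prop} (hφ : DigitDefinable R φ) :
    DigitDefinable R fun n (y : V → ℕ) => ∃ z : W → ℕ, (∀ w, z w < n ^ R) ∧ φ n (Sum.elim y z) := by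
  unfold DigitDefinable at *
  convert IsSemilinearSet.image hφ
    (LinearMap.funLeft ℕ ℕ (Option.map (Prod.map (Sum.inl : V → V ⊕ W) (id : Fin R → Fin R))))
    using 1
  ext x
  simp only [Set.mem_ofPred_eq, Set.mem_image]
  constructor
  · rintro ⟨hx, z, hz, h⟩
    choose d hd hdz using fun w => exists_digits (hz w)
    refine ⟨fun o => o.elim (x none) fun p =>
        p.1.elim (fun v => x (some (v, p.2))) (fun w => d w p.2),
      ⟨⟨hx.1, ?_⟩, ?_⟩, ?_⟩
    · rintro ⟨v | w, r⟩
      exacts [hx.2 (v, r), hd w r]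
    · refine (congr_arg (φ (x none)) ?_).mpr h
      ext (v | w)
      exacts [rfl, hdz w]
    · ext (_ | p) <;> rfl
  · rintro ⟨x, ⟨hx, h⟩, rfl⟩
    refine ⟨⟨hx.1, fun p => hx.2 _⟩, fun w => ofDigits x (.inr w),
      fun w => sum_digits_lt fun r => hx.2 _, ?_⟩
    refine (congr_arg (φ (x none)) ?_).mpr h
    ext (v | w) <;> rfl

/-- The number of solutions below `n ^ R` of a definable condition is eventually
quasi-polynomial. -/
theorem DigitDefinable.isEventuallyQuasiPoly_ncard {φ : ℕ → (Unit → ℕ) → Prop}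
    (hφ : DigitDefinable R φ) :
    IsEventuallyQuasiPoly fun n => ({δ | δ < n ^ R ∧ φ n fun _ => δ}.ncard : ℚ) := by
  classical
  obtain ⟨P, hP, hPs⟩ := IsSemilinearSet.exists_ind_mem_pqp hφ
  obtain ⟨H, hH, hHs⟩ := exists_pqp_sum_box none hP (Finset.univ.erase none) (by simp)
  refine (isEventuallyQuasiPoly_of_mem_pqp none hH).of_eventually_eq 1 fun n hn => ?_
  rw [hHs _ n (by simp)]
  simp only [ind, Finset.sum_boole]
  have hset : {δ | δ < n ^ R ∧ φ n fun _ => δ} =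
      ((Finset.range (n ^ R)).filter fun δ => φ n fun _ => δ : Finset ℕ) := by ext; simp
  rw [hset, Set.ncard_coe_finset, Nat.cast_inj]
  have mem (y : Option (Unit × Fin R) → ℤ) : (y ∈ Fintype.piFinset fun i =>
      if i ∈ Finset.univ.erase none then Finset.Ico (0 : ℤ) n
      else {Function.update (0 : Option (Unit × Fin R) → ℤ) none (n : ℤ) i})
      ↔ y none = n ∧ ∀ p, 0 ≤ y (some p) ∧ y (some p) < n := by
    simp [Fintype.mem_piFinset, Option.forall]
  let x (y : Option (Unit × Fin R) → ℤ) : Option (Unit × Fin R) → ℕ := fun i => (y i).toNat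
  have hx {y : Option (Unit × Fin R) → ℤ} (h : y none = n ∧ ∀ p, 0 ≤ y (some p) ∧ y (some p) < n) :
      x y ∈ digitBox Unit R ∧ x y none = n ∧ (fun i => (x y i : ℤ)) = y := by
    refine ⟨⟨by simp [x, h.1, hn], fun p => ?_⟩, by simp [x, h.1], ?_⟩
    · have := h.2 p
      simp only [x, h.1]
      omega
    · ext (_ | p)
      · simp [x, h.1]
      · simp [x, (h.2 p).1]
  symm
  refine Finset.card_bij (fun y _ => ofDigits (x y) ()) ?_ ?_ ?_
  · intro y hy
    rw [Finset.mem_filter, mem] at hy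
    obtain ⟨h1, h2, h3⟩ := hx hy.1
    rw [← h3, hPs] at hy
    rw [Finset.mem_filter, Finset.mem_range, ← h2]
    exact ⟨sum_digits_lt fun r => h1.2 _, hy.2.2⟩
  · intro y hy y' hy' h
    rw [Finset.mem_filter, mem] at hy hy'
    obtain ⟨h1, h2, h3⟩ := hx hy.1
    obtain ⟨h1', h2', h3'⟩ := hx hy'.1
    simp only [ofDigits, h2, h2'] at h
    have := digits_injective (fun r => h2 ▸ h1.2 _) (fun r => h2' ▸ h1'.2 _) h
    rw [← h3, ← h3']
    ext (_ | ⟨⟨⟩, r⟩)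
    · simp only [h2, h2']
    · exact congr_arg Nat.cast (congr_fun this r)
  · intro δ hδ
    rw [Finset.mem_filter, Finset.mem_range] at hδ
    obtain ⟨d, hd, hdδ⟩ := exists_digits hδ.1
    let u : Option (Unit × Fin R) → ℕ := fun o => o.elim n fun p => d p.2
    have hu : ofDigits u = fun _ => δ := funext fun _ => hdδ
    refine ⟨fun i => u i, ?_, ?_⟩
    · rw [Finset.mem_filter, mem, hPs]
      refine ⟨⟨rfl, fun p => ⟨by positivity, by exact_mod_cast hd p.2⟩⟩, ⟨hn, fun p => hd p.2⟩, ?_⟩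
      rw [hu]
      exact hδ.2
    · have : x (fun i => u i) = u := funext fun i => by simp [x]
      rw [this, hu]

end Digits

section Gaps

theorem single_le_of_le {ι : Type*} [DecidableEq ι] {x : ι → ℕ} {i : ι} {c : ℕ} (hc : c ≤ x i) :
    Pi.single i c ≤ x := by
  intro j
  rcases eq_or_ne j i with rfl | hj
  · simpa using hc
  · simp [hj]

variable {ι : Type*} [Fintype ι]

/-- The value `∑ i, z i * a i` of the factorization `z` with respect to the generators `a`. -/
noncomputable def weight (a : ι → ℕ) : (ι → ℕ) →ₗ[ℕ] ℕ := Fintype.linearCombination ℕ a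

theorem weight_apply (a z : ι → ℕ) : weight a z = ∑ i, z i * a i :=
  Fintype.linearCombination_apply ℕ a z

theorem weight_one_apply (z : ι → ℕ) : weight 1 z = ∑ i, z i := by simp [weight_apply]

theorem weight_single [DecidableEq ι] (a : ι → ℕ) (i : ι) (m : ℕ) :
    weight a (Pi.single i m) = m * a i :=
  Fintype.linearCombination_apply_single ℕ a i m

/-- `z` and `w` are factorizations of the same element with consecutive lengths. -/
def IsGap (a z w : ι → ℕ) : Prop :=
  weight a z = weight a w ∧ weight 1 z < weight 1 w ∧
    ∀ v, weight a v = weight a z → ¬ (weight 1 z < weight 1 v ∧ weight 1 v < weight 1 w)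

theorem IsGap.of_add {a z w z₀ w₀ : ι → ℕ} (h : IsGap a (z + z₀) (w + w₀))
    (ha : weight a z₀ = weight a w₀) (hl : weight 1 z₀ = weight 1 w₀) : IsGap a z w := by
  obtain ⟨h1, h2, h3⟩ := h
  simp only [map_add] at h1 h2 h3
  refine ⟨by omega, by omega, fun v hv hv' => h3 (v + z₀) (by simp only [map_add, hv]) ?_⟩
  simp only [map_add]
  omega

theorem exists_le_of_lt_weight {a z : ι → ℕ} {F K : ℕ} (haF : ∀ i, a i ≤ F)
    (h : Fintype.card ι * (K * F) < weight a z) : ∃ i, K ≤ z i := by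
  by_contra! hz
  refine h.not_ge ?_
  rw [weight_apply]
  simpa using Finset.sum_le_card_nsmul Finset.univ _ _ fun i _ =>
    Nat.mul_le_mul (hz i).le (haF i)

/-- If two factorizations of the same element have very different lengths, the longer one uses some
generator many times which is smaller than a generator used many times by the shorter one. -/
theorem exists_lt_of_weight_eq {a z w : ι → ℕ} {F : ℕ} (G : ℕ) (ha : ∀ i, 1 ≤ a i)
    (haF : ∀ i, a i ≤ F) (h : weight a z = weight a w)
    (hl : weight 1 w + Fintype.card ι * (G * F + G) < weight 1 z) :
    ∃ i j, a i < a j ∧ G ≤ z i ∧ G ≤ w j := by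
  have hne : (Finset.univ.filter fun i => G ≤ z i).Nonempty := by
    obtain ⟨i, hi⟩ := exists_le_of_lt_weight (a := 1) (z := z) (F := 1) (K := G)
      (fun _ => le_rfl) (by
      refine lt_of_le_of_lt ?_ hl
      exact (Nat.mul_le_mul le_rfl (by nlinarith)).trans (Nat.le_add_left _ _))
    exact ⟨i, by simpa using hi⟩
  obtain ⟨i₀, hi₀, hmin⟩ := Finset.exists_min_image _ a hne
  simp only [Finset.mem_filter, Finset.mem_univ, true_and] at hi₀ hmin
  by_contra! hcon
  have hw : weight a w ≤ a i₀ * weight 1 w + Fintype.card ι * (G * F) := by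
    rw [weight_apply a, weight_one_apply, Finset.mul_sum, ← smul_eq_mul (Fintype.card ι),
      ← Finset.card_univ, ← Finset.sum_const, ← Finset.sum_add_distrib]
    refine Finset.sum_le_sum fun j _ => ?_
    rcases le_or_gt (a j) (a i₀) with hj | hj
    · nlinarith [Nat.zero_le (G * F)]
    · have := hcon i₀ j hj hi₀
      nlinarith [haF j]
  have hz : a i₀ * weight 1 z ≤ weight a z + Fintype.card ι * (a i₀ * G) := by
    rw [weight_apply a, weight_one_apply, Finset.mul_sum, ← smul_eq_mul (Fintype.card ι),
      ← Finset.card_univ, ← Finset.sum_const, ← Finset.sum_add_distrib]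
    refine Finset.sum_le_sum fun i _ => ?_
    rcases le_or_gt G (z i) with hi | hi
    · nlinarith [hmin i hi, Nat.zero_le (a i₀ * G)]
    · nlinarith [Nat.zero_le (z i * a i)]
  have h1 : Fintype.card ι * (G * F) ≤ a i₀ * (Fintype.card ι * (G * F)) :=
    Nat.le_mul_of_pos_left _ (ha i₀)
  have h2 := Nat.mul_le_mul_left (a i₀) (Nat.succ_le_of_lt hl)
  have h3 := ha i₀
  rw [h] at hz
  nlinarith

/-- Two exchanges with opposite effects on the length can be combined into one that preserves
the length. -/
theorem exists_length_preserving [DecidableEq ι] {a z w : ι → ℕ} {F q : ℕ} (ha : ∀ i, 1 ≤ a i)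
    (haF : ∀ i, a i ≤ F) (hq : F ≤ q) {i j s t : ι} (hs : F * F ≤ z s) (ht : F * F ≤ w t)
    (hd : a i < a j ∧ a t < a s ∨ a j < a i ∧ a s < a t) :
    ∃ z₀ w₀, z₀ ≤ z + Pi.single i (q * a j) ∧ w₀ ≤ w + Pi.single j (q * a i) ∧
      weight a z₀ = weight a w₀ ∧ weight 1 z₀ = weight 1 w₀ ∧ 0 < weight a z₀ := by
  obtain ⟨m, m', hm, hm0, hmF, hmF'⟩ : ∃ m m' : ℕ, m * a j + m' * a t = m * a i + m' * a s ∧ 0 < m ∧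
      m ≤ F ∧ m' ≤ F := by
    have := haF i; have := haF j; have := haF s; have := haF t
    rcases hd with ⟨h, h'⟩ | ⟨h, h'⟩
    · obtain ⟨d, hd⟩ := Nat.exists_eq_add_of_lt h
      obtain ⟨d', hd'⟩ := Nat.exists_eq_add_of_lt h'
      exact ⟨d' + 1, d + 1, by rw [hd, hd']; ring, by omega, by omega, by omega⟩
    · obtain ⟨d, hd⟩ := Nat.exists_eq_add_of_lt h
      obtain ⟨d', hd'⟩ := Nat.exists_eq_add_of_lt h'
      exact ⟨d' + 1, d + 1, by rw [hd, hd']; ring, by omega, by omega, by omega⟩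
  have single_mono (p : ι) {c c' : ℕ} (hc : c ≤ c') :
      (Pi.single p c : ι → ℕ) ≤ Pi.single p c' := single_le_of_le (by simpa using hc)
  refine ⟨Pi.single s (m' * a t) + Pi.single i (m * a j),
    Pi.single t (m' * a s) + Pi.single j (m * a i), ?_, ?_, ?_, ?_, ?_⟩
  · exact add_le_add (single_le_of_le ((Nat.mul_le_mul hmF' (haF t)).trans hs))
      (single_mono i (Nat.mul_le_mul_right _ (hmF.trans hq)))
  · exact add_le_add (single_le_of_le ((Nat.mul_le_mul hmF' (haF s)).trans ht))
      (single_mono j (Nat.mul_le_mul_right _ (hmF.trans hq)))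
  · simp only [map_add, weight_single]
    ring
  · simp only [map_add, weight_single, Pi.one_apply]
    linarith
  · simp only [map_add, weight_single]
    have := Nat.mul_pos (Nat.mul_pos hm0 (ha j)) (ha i)
    omega

/-- A bound for the smallest elements that realize a gap. -/
def gapBound (k F : ℕ) : ℕ := k * ((k * (F * F * F + F * F) + F + 2) * F * F)

theorem IsGap.exists_length_preserving {a z w : ι → ℕ} {F : ℕ} (ha : ∀ i, 1 ≤ a i)
    (haF : ∀ i, a i ≤ F) (h : IsGap a z w) (hB : gapBound (Fintype.card ι) F < weight a z) :
    ∃ z₀ w₀, z₀ ≤ z ∧ w₀ ≤ w ∧ weight a z₀ = weight a w₀ ∧ weight 1 z₀ = weight 1 w₀ ∧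
      0 < weight a z₀ := by
  classical
  obtain ⟨i, hi⟩ := exists_le_of_lt_weight haF hB
  obtain ⟨j, hj⟩ := exists_le_of_lt_weight haF (h.1 ▸ hB)
  set C := Fintype.card ι * (F * F * F + F * F) with hC
  set q := C + F + 2 with hq
  have hzi : q * a j ≤ z i := (Nat.mul_le_mul le_rfl (haF j)).trans hi
  have hwj : q * a i ≤ w j := (Nat.mul_le_mul le_rfl (haF i)).trans hj
  obtain ⟨z', rfl⟩ := exists_add_of_le (single_le_of_le hzi)
  obtain ⟨w', rfl⟩ := exists_add_of_le (single_le_of_le hwj)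
  simp only [add_comm (Pi.single _ _) _] at h ⊢
  obtain ⟨h1, h2, h3⟩ := h
  simp only [map_add, weight_single, Pi.one_apply, mul_one] at h1 h2 h3
  have h1' : weight a z' = weight a w' := by nlinarith
  rcases lt_trichotomy (a i) (a j) with hij | hij | hij
  · obtain ⟨s, t, hst, hs, ht⟩ := exists_lt_of_weight_eq (F * F) ha haF h1'.symm (by
      rw [← hC]
      nlinarith)
    exact _root_.exists_length_preserving ha haF (by omega) ht hs (.inl ⟨hij, hst⟩)
  · refine ⟨Pi.single i (q * a j), Pi.single j (q * a i), le_add_self, le_add_self, ?_, ?_, ?_⟩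
    · simp only [weight_single]
      ring
    · simp only [weight_single, hij, Pi.one_apply]
    · rw [weight_single]
      exact Nat.mul_pos (Nat.mul_pos (by omega) (ha j)) (ha i)
  · have h4 := h3 (z' + Pi.single i ((q - 1) * a j) + Pi.single j (a i)) (by
      simp only [map_add, weight_single]
      obtain ⟨r, hr⟩ : ∃ r, q = r + 1 := ⟨C + F + 1, rfl⟩
      rw [hr, Nat.add_sub_cancel]
      ring)
    simp only [map_add, weight_single, Pi.one_apply, mul_one] at h4
    obtain ⟨r, hr⟩ : ∃ r, q = r + 1 := ⟨C + F + 1, rfl⟩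
    rw [hr, Nat.add_sub_cancel] at h4
    have h5 : weight 1 w' + r * a i ≤ weight 1 z' + r * a j := by
      by_contra! h6
      exact h4 ⟨by nlinarith, by nlinarith⟩
    have h6 : r * (a j + 1) ≤ r * a i := Nat.mul_le_mul_left r hij
    obtain ⟨s, t, hst, hs, ht⟩ := exists_lt_of_weight_eq (F * F) ha haF h1' (by
      rw [← hC]
      nlinarith)
    exact _root_.exists_length_preserving ha haF (by omega) hs ht (.inr ⟨hij, hst⟩)

/-- Every gap length is realized by an element below `gapBound`. -/
theorem IsGap.exists_weight_le_gapBound {a z w : ι → ℕ} {F : ℕ} (ha : ∀ i, 1 ≤ a i)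
    (haF : ∀ i, a i ≤ F) (h : IsGap a z w) :
    ∃ z' w', IsGap a z' w' ∧ weight 1 w' - weight 1 z' = weight 1 w - weight 1 z ∧
      weight a z' ≤ gapBound (Fintype.card ι) F := by
  induction hm : weight a z using Nat.strong_induction_on generalizing z w with
  | _ m ih =>
    subst hm
    rcases le_or_gt (weight a z) (gapBound (Fintype.card ι) F) with hB | hB
    · exact ⟨z, w, h, rfl, hB⟩
    · obtain ⟨z₀, w₀, hz, hw, hv, hl, hpos⟩ := h.exists_length_preserving ha haF hB
      obtain ⟨z', rfl⟩ := exists_add_of_le hz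
      obtain ⟨w', rfl⟩ := exists_add_of_le hw
      rw [add_comm z₀, add_comm w₀] at h
      obtain ⟨z'', w'', h1, h2, h3⟩ :=
        ih (weight a z') (by rw [map_add]; omega) (h.of_add hv hl) rfl
      exact ⟨z'', w'', h1, by rw [h2]; simp only [map_add]; omega, h3⟩

end Gaps

section DeltaSets

theorem IsEventuallyQuasiPoly.isEQP {g : ℕ → ℤ}
    (h : IsEventuallyQuasiPoly fun n => (g n : ℚ)) : IsEQP g := by
  obtain ⟨N, p, P, hp, h⟩ := h
  refine ⟨(Finset.range p).sup fun r => (P r).natDegree,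
    fun i n => if n < N then (if i = 0 then (g n : ℚ) else 0) else (P (n % p)).coeff i,
    fun i _ => ⟨N, p, hp, fun n hn => ?_⟩, fun n => ?_⟩
  · simp [hn.not_gt, (hn.trans (Nat.le_add_right n p)).not_gt]
  · rcases lt_or_ge n N with hn | hn
    · simp [hn]
    · simp only [hn.not_gt, if_false]
      rw [← Polynomial.eval_eq_sum_range' (Nat.lt_succ_of_le
        (Finset.le_sup (f := fun r => (P r).natDegree) (Finset.mem_range.2 (Nat.mod_lt n hp))))]
      exact h n hn

theorem exists_eval_lt_pow (Q : Polynomial ℤ) :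
    ∃ R N : ℕ, ∀ n ≥ N, Q.eval (n : ℤ) < (n : ℤ) ^ R := by
  set c := ∑ i ∈ Finset.range (Q.natDegree + 1), |Q.coeff i| with hc
  have hc0 : 0 ≤ c := Finset.sum_nonneg fun i _ => abs_nonneg _
  refine ⟨Q.natDegree + 1, c.toNat + 1, fun n hn => ?_⟩
  have hn' : c < n := by omega
  have hn1 : (1 : ℤ) ≤ n := by omega
  calc Q.eval (n : ℤ) ≤ c * (n : ℤ) ^ Q.natDegree := by
        rw [Polynomial.eval_eq_sum_range, hc, Finset.sum_mul]
        refine Finset.sum_le_sum fun i hi => ?_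
        exact mul_le_mul (le_abs_self _)
          (pow_le_pow_right₀ hn1 (Nat.lt_succ_iff.1 (Finset.mem_range.1 hi))) (by positivity)
          (abs_nonneg _)
    _ < n * (n : ℤ) ^ Q.natDegree := by gcongr
    _ = _ := by ring

theorem exists_eval_ne_zero {Q : Polynomial ℤ} (hQ : Q ≠ 0) :
    ∃ N : ℕ, ∀ n ≥ N, Q.eval (n : ℤ) ≠ 0 := by
  refine ⟨∑ r ∈ Q.roots.toFinset, r.natAbs + 1, fun n hn h => ?_⟩
  have h1 : (n : ℤ) ∈ Q.roots.toFinset := by simp [hQ, h]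
  have h2 := Finset.single_le_sum (f := Int.natAbs) (fun _ _ => Nat.zero_le _) h1
  simp only [Int.natAbs_natCast] at h2
  omega

variable {k : ℕ} {f : Fin k → ℕ → ℕ}

theorem mem_bigDelta_iff {n δ : ℕ} : δ ∈ BigDelta k f n ↔
    ∃ z w, IsGap (fun i => f i n) z w ∧ weight 1 w = weight 1 z + δ := by
  simp only [BigDelta, DeltaSetOf, LSet, Set.mem_iUnion, Set.mem_ofPred_eq, exists_prop, IsGap,
    weight_one_apply]
  simp only [weight_apply]
  constructor
  · rintro ⟨m, -, _, _, ⟨z, rfl, rfl⟩, ⟨w, hw, rfl⟩, hlt, rfl, h⟩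
    exact ⟨z, w, ⟨hw.symm, hlt, fun v hv => h _ ⟨v, hv, rfl⟩⟩, by omega⟩
  · rintro ⟨z, w, ⟨h1, h2, h3⟩, h4⟩
    refine ⟨_, ?_, _, _, ⟨z, rfl, rfl⟩, ⟨w, h1.symm, rfl⟩, h2, by omega, ?_⟩
    · exact AddSubmonoid.sum_mem _ fun i _ => by
        exact AddSubmonoid.nsmul_mem _
          (AddSubmonoid.subset_closure (Set.mem_range_self i)) (z i)
    · rintro _ ⟨v, hv, rfl⟩
      exact h3 v hv

theorem bigDelta_eq_singleton {n : ℕ} {i : Fin k} (hi : f i n = 0) : BigDelta k f n = {1} := by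
  ext δ
  rw [mem_bigDelta_iff, Set.mem_singleton_iff]
  constructor
  · rintro ⟨z, w, ⟨-, h2, h3⟩, h4⟩
    have := h3 (z + Pi.single i 1) (by simp [weight_single, hi])
    simp only [map_add, weight_single, Pi.one_apply] at this
    omega
  · rintro rfl
    refine ⟨0, Pi.single i 1, ⟨by simp [weight_single, hi], by simp [weight_single],
      fun v _ => ?_⟩, by simp [weight_single]⟩
    simp only [map_zero, weight_single, Pi.one_apply]
    omega

theorem le_weight {a : Fin k → ℕ} (ha : ∀ i, 1 ≤ a i) (z : Fin k → ℕ) (i : Fin k) :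
    z i ≤ weight a z := by
  rw [weight_apply]
  exact (Nat.le_mul_of_pos_right _ (ha i)).trans
    (Finset.single_le_sum (f := fun i => z i * a i) (fun _ _ => Nat.zero_le _) (Finset.mem_univ i))

theorem weight_one_le_weight {a : Fin k → ℕ} (ha : ∀ i, 1 ≤ a i) (z : Fin k → ℕ) :
    weight 1 z ≤ weight a z := by
  rw [weight_one_apply, weight_apply]
  exact Finset.sum_le_sum fun i _ => Nat.le_mul_of_pos_right _ (ha i)

theorem DigitDefinable.of_linear {V : Type*} [Fintype V] {R : ℕ} {φ : ℕ → (V → ℕ) → Prop}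
    (p : V → Polynomial ℤ) (q : Polynomial ℤ)
    (h : ∀ n y, φ n y ↔ ∑ v, (p v).eval (n : ℤ) * (y v : ℤ) + q.eval (n : ℤ) = 0) :
    DigitDefinable R φ := by
  have : φ = _ := funext fun n => funext fun y => propext (h n y)
  rw [this]
  exact digitDefinable_linear_eq_zero p q

/-- The right part of `y` consists of a factorization and of two numbers which witness that its
length is strictly between those of the two factorizations in the left part. -/
def IsBetween (f : Fin k → ℕ → ℕ) (n : ℕ)
    (y : (Unit ⊕ (Fin k ⊕ (Fin k ⊕ Unit))) ⊕ (Fin k ⊕ Bool) → ℕ) : Prop :=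
  weight (fun i => f i n) (fun i => y (.inr (.inl i))) =
      weight (fun i => f i n) (fun i => y (.inl (.inr (.inl i)))) ∧
    weight 1 (fun i => y (.inr (.inl i))) =
      weight 1 (fun i => y (.inl (.inr (.inl i)))) + y (.inr (.inr false)) + 1 ∧
    weight 1 (fun i => y (.inl (.inr (.inr (.inl i))))) =
      weight 1 (fun i => y (.inr (.inl i))) + y (.inr (.inr true)) + 1

/-- `y` consists of a number and of two factorizations of the same element, which is the
last entry. The lengths differ by that number, with no length in between witnessed by numbers
below `n ^ R`. -/
def IsBoundedGap (f : Fin k → ℕ → ℕ) (R n : ℕ) (y : Unit ⊕ (Fin k ⊕ (Fin k ⊕ Unit)) → ℕ) : Prop :=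
  (weight (fun i => f i n) (fun i => y (.inr (.inl i))) =
      weight (fun i => f i n) (fun i => y (.inr (.inr (.inl i)))) ∧
    weight 1 (fun i => y (.inr (.inr (.inl i)))) =
      weight 1 (fun i => y (.inr (.inl i))) + y (.inl ())) ∧
  weight (fun i => f i n) (fun i => y (.inr (.inl i))) = y (.inr (.inr (.inr ()))) ∧
  ¬ y (.inl ()) = 0 ∧
  ¬ ∃ t : Fin k ⊕ Bool → ℕ, (∀ i, t i < n ^ R) ∧ IsBetween f n (Sum.elim y t)

theorem digitDefinable_isBetween (R : ℕ) {p : Fin k → Polynomial ℤ}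
    (hp : ∀ i (n : ℕ), (f i n : ℤ) = (p i).eval (n : ℤ)) : DigitDefinable R (IsBetween f) := by
  refine .and (.of_linear (Sum.elim (Sum.elim 0 (Sum.elim (-p) 0)) (Sum.elim p 0)) 0 ?_)
    (.and (.of_linear (Sum.elim (Sum.elim 0 (Sum.elim (-1) 0))
        (Sum.elim 1 fun b => if b then 0 else -1)) (-1) ?_)
      (.of_linear (Sum.elim (Sum.elim 0 (Sum.elim 0 (Sum.elim 1 0)))
        (Sum.elim (-1) fun b => if b then -1 else 0)) (-1) ?_)) <;>
  · intro n y
    rw [← Nat.cast_inj (R := ℤ)]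
    simp [weight_apply, hp, Fintype.sum_sum_type, mul_comm (Polynomial.eval _ _)]
    constructor <;> intro h <;> linarith

theorem digitDefinable_isBoundedGap (R : ℕ) {p : Fin k → Polynomial ℤ}
    (hp : ∀ i (n : ℕ), (f i n : ℤ) = (p i).eval (n : ℤ)) :
    DigitDefinable R (IsBoundedGap f R) := by
  refine .and (.and (.of_linear (Sum.elim 0 (Sum.elim p (Sum.elim (-p) 0))) 0 ?_)
    (.of_linear (Sum.elim (-1) (Sum.elim (-1) (Sum.elim 1 0))) 0 ?_))
    (.and (.of_linear (Sum.elim 0 (Sum.elim p (Sum.elim 0 (-1)))) 0 ?_)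
      (.and (.not (.of_linear (Sum.elim 1 0) 0 ?_))
      (.not (digitDefinable_isBetween R hp).exists))) <;>
  · intro n y
    rw [← Nat.cast_inj (R := ℤ)]
    simp [weight_apply, hp, Fintype.sum_sum_type, mul_comm (Polynomial.eval _ _)]
    try constructor <;> intro h <;> linarith

theorem mem_bigDelta_iff_of_lt_pow {n R F δ : ℕ} (ha : ∀ i, 1 ≤ f i n) (haF : ∀ i, f i n ≤ F)
    (hR : gapBound k F < n ^ R) :
    δ ∈ BigDelta k f n ↔ δ < n ^ R ∧ ∃ zw : Fin k ⊕ (Fin k ⊕ Unit) → ℕ, (∀ i, zw i < n ^ R) ∧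
      IsBoundedGap f R n (Sum.elim (fun _ => δ) zw) := by
  rw [mem_bigDelta_iff]
  constructor
  · rintro ⟨z, w, h, hδ⟩
    obtain ⟨z', w', h', hδ', hB⟩ := h.exists_weight_le_gapBound ha haF
    rw [Fintype.card_fin] at hB
    obtain ⟨h1, h2, h3⟩ := h'
    have hl := weight_one_le_weight ha w'
    have hδ0 := h.2.1
    refine ⟨by omega, Sum.elim z' (Sum.elim w' fun _ => weight (fun i => f i n) z'), ?_,
      ⟨h1, show weight 1 w' = weight 1 z' + δ by omega⟩, rfl, show δ ≠ 0 by omega, ?_⟩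
    · rintro (i | i | i)
      · exact (le_weight ha z' i).trans_lt (by omega)
      · exact (le_weight ha w' i).trans_lt (by omega)
      · exact hB.trans_lt hR
    · rintro ⟨t, -, h4, h5, h6⟩
      change weight 1 (fun i => t (.inl i)) = weight 1 z' + t (.inr false) + 1 at h5
      change weight 1 w' = weight 1 (fun i => t (.inl i)) + t (.inr true) + 1 at h6
      exact h3 (fun i => t (.inl i)) h4 ⟨by omega, by omega⟩
  · rintro ⟨-, zw, hzw, ⟨h1, h2⟩, h3, h4, h5⟩
    have hm := hzw (.inr (.inr ()))
    simp only [Sum.elim_inl, Sum.elim_inr] at h1 h2 h3 h4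
    refine ⟨_, _, ⟨h1, by omega, fun v hv hlt => h5 ?_⟩, h2⟩
    have hv' := weight_one_le_weight ha v
    have hw' := weight_one_le_weight ha fun i => zw (.inr (.inl i))
    refine ⟨Sum.elim v fun b => if b then
        weight 1 (fun i => zw (.inr (.inl i))) - weight 1 v - 1
      else weight 1 v - weight 1 (fun i => zw (.inl i)) - 1, ?_, hv, ?_, ?_⟩
    · rintro (i | _ | _)
      · exact (le_weight ha v i).trans_lt (by omega)
      · simp only [Sum.elim_inr, Bool.false_eq_true, if_false]
        omega
      · simp only [Sum.elim_inr, if_true]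
        omega
    · change weight 1 v = weight 1 (fun i => zw (.inl i)) +
        (weight 1 v - weight 1 (fun i => zw (.inl i)) - 1) + 1
      omega
    · change weight 1 (fun i => zw (.inr (.inl i))) = weight 1 v +
        (weight 1 (fun i => zw (.inr (.inl i))) - weight 1 v - 1) + 1
      omega

theorem isEventuallyQuasiPoly_ncard_bigDelta {p : Fin k → Polynomial ℤ}
    (hp : ∀ i (n : ℕ), (f i n : ℤ) = (p i).eval (n : ℤ)) (hp0 : ∀ i, p i ≠ 0) :
    IsEventuallyQuasiPoly fun n => ((BigDelta k f n).ncard : ℚ) := by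
  choose N hN using fun i => exists_eval_ne_zero (hp0 i)
  let S := ∑ i, p i
  obtain ⟨R, M, hR⟩ := exists_eval_lt_pow
    ((k : Polynomial ℤ) * ((k * (S * S * S + S * S) + S + 2) * S * S))
  refine ((digitDefinable_isBoundedGap R hp).exists.isEventuallyQuasiPoly_ncard).of_eventually_eq
    (M + ∑ i, N i) fun n hn => ?_
  have ha (i : Fin k) : 1 ≤ f i n := by
    have h1 : N i ≤ n :=
      (Finset.single_le_sum (fun _ _ => Nat.zero_le _) (Finset.mem_univ i)).trans (by omega)
    have h2 := hN i n h1
    rw [← hp] at h2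
    omega
  have haF (i : Fin k) : f i n ≤ ∑ i, f i n :=
    Finset.single_le_sum (f := fun i => f i n) (fun _ _ => Nat.zero_le _) (Finset.mem_univ i)
  have hB : gapBound k (∑ i, f i n) < n ^ R := by
    have h1 := hR n (by omega)
    have h2 : S.eval (n : ℤ) = ((∑ i, f i n : ℕ) : ℤ) := by
      simp [S, Polynomial.eval_finsetSum, hp]
    simp only [Polynomial.eval_mul, Polynomial.eval_add, Polynomial.eval_natCast,
      Polynomial.eval_ofNat, h2] at h1
    unfold gapBound
    exact_mod_cast h1
  congr 2
  ext δ
  exact mem_bigDelta_iff_of_lt_pow ha haF hB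

end DeltaSets

theorem stmt8 (k : ℕ) (hk : 1 ≤ k) (f : Fin k → ℕ → ℕ)
    (hf : ∀ i, ∃ p : Polynomial ℤ, ∀ n : ℕ, (f i n : ℤ) = p.eval (n : ℤ)) :
    ∃ g : ℕ → ℤ, IsEQP g ∧
      ∀ n : ℕ, (BigDelta k f n).Finite →
        g n = ((BigDelta k f n).ncard : ℤ) := by
  choose p hp using hf
  refine ⟨fun n => (BigDelta k f n).ncard, IsEventuallyQuasiPoly.isEQP ?_, fun n _ => rfl⟩
  by_cases h : ∃ i, p i = 0
  · obtain ⟨i, hi⟩ := h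
    have hfi (n : ℕ) : f i n = 0 := by
      have := hp i n
      rw [hi, Polynomial.eval_zero] at this
      exact_mod_cast this
    simpa [bigDelta_eq_singleton (hfi _)] using isEventuallyQuasiPoly_polynomial 1
  · push Not at h
    simpa using isEventuallyQuasiPoly_ncard_bigDelta hp h
end
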